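/- arXiv:0809.2068 — 2 statements merged into one kernel-verified Lean document; each statement's English description precedes it below -/
import Mathlib

section
/- Let Q be a commutative Noetherian ring of finite Krull dimension, let f_1,…,f_c be a regular sequence in Q, and set A = Q/(f_1,…,f_c). Let M be a finitely generated A-module whose projective dimension over Q (via the quotient map Q → A) is finite. Let I be an ideal of A and D a finitely generated A-module. Then there exist a positive integer l and indices i_0, n_0 such that for all i ≥ i_0 and n ≥ n_0 there is an injective A-module homomorphism Ext^i_A(M, I^n D) → ( Ext^{i+2}_A(M, I^{n+1} D) )^l. In particular Ass_A Ext^i_A(M, I^n D) ⊆ Ass_A Ext^{i+2}_A(M, I^{n+1} D) for all i ≥ i_0 and n ≥ n_0. -/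
open CategoryTheory

/-- The `i`-th Ext module `Ext^i_A(M, N)` of `A`-modules, as a type. -/
noncomputable abbrev extAP (A : Type) [CommRing A] (M N : Type) [AddCommGroup M] [Module A M]
    [AddCommGroup N] [Module A N] (i : ℕ) : Type :=
  ((Ext A (ModuleCat A) i).obj (Opposite.op (ModuleCat.of A M))).obj (ModuleCat.of A N)


open CategoryTheory

/-- A graded module with a degree `-1` map `d` and anticommuting degree `+1` maps `e j`
with `d e_j + e_j d = f_j`. -/
structure KMod {Q : Type} [CommRing Q] {c : ℕ} (f : Fin c → Q) (X : Type) [AddCommGroup X]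
    [Module Q X] where
  p : ℤ → (X →ₗ[Q] X)
  d : X →ₗ[Q] X
  e : Fin c → (X →ₗ[Q] X)
  pp : ∀ i x, p i (p i x) = p i x
  orth : ∀ i j x, i ≠ j → p i (p j x) = 0
  dp : ∀ i x, d (p i x) = p (i - 1) (d x)
  ep : ∀ j i x, e j (p i x) = p (i + 1) (e j x)
  de : ∀ j x, d (e j x) + e j (d x) = f j • x
  ee : ∀ i j x, e i (e j x) + e j (e i x) = 0
  esq : ∀ i x, e i (e i x) = 0

namespace KMod

variable {Q : Type} [CommRing Q]

/-- forget the first operator -/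
def tail {c : ℕ} {f : Fin (c + 1) → Q} {X : Type} [AddCommGroup X] [Module Q X]
    (K : KMod f X) : KMod (fun j : Fin c => f j.succ) X where
  p := K.p
  d := K.d
  e := fun j => K.e j.succ
  pp := K.pp
  orth := K.orth
  dp := K.dp
  ep := fun j => K.ep j.succ
  de := fun j => K.de j.succ
  ee := fun i j => K.ee i.succ j.succ
  esq := fun i => K.esq i.succ

/-- induce along one more operator -/
def ind {c : ℕ} {f : Fin (c + 1) → Q} {Y : Type} [AddCommGroup Y] [Module Q Y]
    (K : KMod (fun j : Fin c => f j.succ) Y) : KMod f (Y × Y) where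
  p := fun i => (K.p i).prodMap (K.p (i - 1))
  d := LinearMap.prod (K.d ∘ₗ LinearMap.fst Q Y Y + f 0 • LinearMap.snd Q Y Y)
    (-(K.d ∘ₗ LinearMap.snd Q Y Y))
  e := Fin.cons (LinearMap.prod 0 (LinearMap.fst Q Y Y))
    (fun j => (K.e j).prodMap (-(K.e j)))
  pp := fun i x => by simp [K.pp]
  orth := fun i j x h => by
    have : i - 1 ≠ j - 1 := by lia
    simp [K.orth _ _ _ h, K.orth _ _ _ this]
  dp := fun i x => by simp [K.dp]
  ep := fun j i x => by
    refine Fin.cases ?_ (fun j => ?_) j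
    · simp
    · simp [K.ep]
  de := fun j x => by
    refine Fin.cases ?_ (fun j => ?_) j
    · ext <;> simp
    · have h1 := K.de j x.1
      have h2 := K.de j x.2
      ext
      · simp [← h1]; abel
      · simp [← h2]
  ee := fun i j x => by
    refine Fin.cases ?_ (fun i => ?_) i <;> refine Fin.cases ?_ (fun j => ?_) j
    · simp
    · ext <;> simp
    · ext <;> simp
    · ext <;> simp [K.ee]
  esq := fun i x => by
    refine Fin.cases ?_ (fun i => ?_) i
    · simp
    · ext <;> simp [K.esq]

theorem cell {M : Type} [AddCommGroup M] [Module Q M] {F : Type} [AddCommGroup F] [Module Q F]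
    [Module.Finite Q F] [Module.Projective Q F] {X : Type} [AddCommGroup X] [Module Q X] (n : ℤ)
    (ζ : F →ₗ[Q] X) (ε : X →ₗ[Q] M) (c : ℕ) : ∀ (f : Fin c → Q) (K : KMod f X)
    (_ : ∀ a, K.d (ζ a) = 0) (_ : ∀ a, K.p n (ζ a) = ζ a)
    (_ : ∀ j x, ε (K.e j x) = 0) (_ : ∀ a, ε (ζ a) = 0),
    ∃ (Y : Type) (_ : AddCommGroup Y) (_ : Module Q Y) (_ : Module.Finite Q Y)
      (_ : Module.Projective Q Y) (L : KMod f Y) (g : Y →ₗ[Q] X) (ι : F →ₗ[Q] Y),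
      (∀ y, L.d (L.d y) = 0) ∧ (∀ i < 0, ∀ y, L.p i y = 0) ∧
      (∀ y, g (L.d y) = K.d (g y)) ∧ (∀ j y, g (L.e j y) = K.e j (g y)) ∧
      (∀ i y, g (L.p i y) = K.p (i + n) (g y)) ∧
      (∀ a, L.p 0 (ι a) = ι a) ∧ (∀ a, L.d (ι a) = 0) ∧ (∀ a, g (ι a) = ζ a) ∧
      (∀ y, ε (g y) = 0) := by
  classical
  induction c with
  | zero =>
    intro f K h1 h2 h3 h4
    refine ⟨F, inferInstance, inferInstance, inferInstance, inferInstance,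
      { p := fun i => if i = 0 then LinearMap.id else 0
        d := 0
        e := fun j => j.elim0
        pp := fun i x => by split_ifs <;> simp
        orth := fun i j x h => by
          by_cases hi : i = 0
          · have : j ≠ 0 := by lia
            simp [this]
          · simp [hi]
        dp := by simp
        ep := fun j => j.elim0
        de := fun j => j.elim0
        ee := fun j => j.elim0
        esq := fun j => j.elim0 }, ζ, LinearMap.id, ?_, ?_, ?_, ?_, ?_, ?_, ?_, ?_, ?_⟩
    · simp
    · intro i hi y; simp [hi.ne]
    · simp [h1]
    · exact fun j => j.elim0
    · intro i y
      by_cases hi : i = 0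
      · simp [hi, h2]
      · have : i + n ≠ n := by lia
        rw [← h2 y, K.orth _ _ _ this]; simp [hi]
    · simp
    · simp
    · simp
    · exact h4
  | succ c ih =>
    intro f K h1 h2 h3 h4
    obtain ⟨Y, _, _, _, _, L, g, ι, a1, a2, a3, a4, a5, a6, a7, a8, a9⟩ :=
      ih (fun j => f j.succ) K.tail h1 h2 (fun j => h3 j.succ) h4
    refine ⟨Y × Y, inferInstance, inferInstance, inferInstance, inferInstance, L.ind,
      LinearMap.coprod g (K.e 0 ∘ₗ g), LinearMap.inl Q Y Y ∘ₗ ι, ?_, ?_, ?_, ?_, ?_, ?_, ?_, ?_, ?_⟩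
    · intro y; ext <;> simp [ind, a1]
    · intro i hi y
      have : i - 1 < 0 := by lia
      ext <;> simp [ind, a2 _ hi, a2 _ this]
    · intro y
      have := K.de 0 (g y.2)
      have b1 := a3 y.1
      have b2 := a3 y.2
      simp only [tail] at b1 b2
      simp [ind, b1, b2, ← this]; abel
    · intro j y
      refine Fin.cases ?_ (fun j => ?_) j
      · simp [ind, K.esq]
      · have b1 := a4 j y.1
        have b2 := a4 j y.2
        have := K.ee j.succ 0 (g y.2)
        simp only [tail] at b1 b2
        simp [ind, b1, b2, eq_neg_of_add_eq_zero_left this]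
    · intro i y
      have b1 := a5 i y.1
      have b2 := a5 (i-1) y.2
      simp only [tail] at b1 b2
      have : i - 1 + n + 1 = i + n := by ring
      simp [ind, b1, b2, K.ep, this]
    · intro a; simp [ind, a6]
    · intro a; simp [ind, a7]
    · intro a; simp [a8]
    · intro y; simp [a9, h3]

/-- mapping cone -/
def cone {c : ℕ} {f : Fin c → Q} {X Y : Type} [AddCommGroup X] [Module Q X]
    [AddCommGroup Y] [Module Q Y] (K : KMod f X) (L : KMod f Y) (n : ℤ) (g : Y →ₗ[Q] X)
    (he : ∀ j y, g (L.e j y) = K.e j (g y))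
    (hp : ∀ i y, g (L.p i y) = K.p (i + n) (g y)) : KMod f (X × Y) where
  p := fun i => (K.p i).prodMap (L.p (i - n - 1))
  d := LinearMap.prod (LinearMap.coprod K.d g) (-(L.d ∘ₗ LinearMap.snd Q X Y))
  e := fun j => (K.e j).prodMap (-(L.e j))
  pp := fun i x => by simp [K.pp, L.pp]
  orth := fun i j x h => by
    have : i - n - 1 ≠ j - n - 1 := by lia
    simp [K.orth _ _ _ h, L.orth _ _ _ this]
  dp := fun i x => by
    have h1 : i - n - 1 + n = i - 1 := by ring
    have h2 : i - 1 - n - 1 = i - n - 1 - 1 := by ring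
    simp [K.dp, L.dp, hp, h1, h2]
  ep := fun j i x => by
    have h2 : i + 1 - n - 1 = i - n - 1 + 1 := by ring
    simp [K.ep, L.ep, h2]
  de := fun j x => by
    ext
    · simp [← K.de, he]; abel
    · simp [← L.de]
  ee := fun i j x => by ext <;> simp [K.ee, L.ee]
  esq := fun i x => by ext <;> simp [K.esq, L.esq]

end KMod

open CategoryTheory

/-- A `KMod` resolving `M` in degrees `< n`. -/
structure Stage {Q : Type} [CommRing Q] {c : ℕ} (f : Fin c → Q) (M : Type) [AddCommGroup M]
    [Module Q M] (n : ℤ) where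
  X : Type
  [i1 : AddCommGroup X]
  [i2 : Module Q X]
  [fin : Module.Finite Q X]
  [proj : Module.Projective Q X]
  K : KMod f X
  ε : X →ₗ[Q] M
  dd : ∀ x, K.d (K.d x) = 0
  neg : ∀ i < 0, ∀ x, K.p i x = 0
  surj : Function.Surjective ε
  εp : ∀ x, ε (K.p 0 x) = ε x
  εd : ∀ x, ε (K.d x) = 0
  εe : ∀ j x, ε (K.e j x) = 0
  exact : ∀ i < n, ∀ x, K.p i x = x → K.d x = 0 → ε x = 0 → ∃ y, K.d (K.p (i + 1) y) = x

attribute [instance] Stage.i1 Stage.i2 Stage.fin Stage.proj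

theorem exists_stage {Q : Type} [CommRing Q] [IsNoetherianRing Q] {c : ℕ} (f : Fin c → Q)
    (M : Type) [AddCommGroup M] [Module Q M] [Module.Finite Q M] (hf : ∀ j (m : M), f j • m = 0)
    (n : ℕ) : Nonempty (Stage f M n) := by
  classical
  induction n with
  | zero =>
    obtain ⟨k, ζ, hζ⟩ := Module.Finite.exists_fin' Q M
    let K : KMod f M :=
      { p := fun i => if i = 0 then LinearMap.id else 0
        d := 0
        e := fun j => 0
        pp := fun i x => by split_ifs <;> simp
        orth := fun i j x h => by
          by_cases hi : i = 0
          · have : j ≠ 0 := by lia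
            simp [this]
          · simp [hi]
        dp := by simp
        ep := by simp
        de := by simp [hf]
        ee := by simp
        esq := by simp }
    obtain ⟨Y, _, _, _, _, L, g, ι, a1, a2, a3, a4, a5, a6, a7, a8, a9⟩ :=
      KMod.cell (M := M) 0 ζ (0 : M →ₗ[Q] M) c f K (by simp [K]) (by simp [K]) (by simp) (by simp)
    refine ⟨⟨Y, L, g, a1, a2, ?_, ?_, ?_, ?_, ?_⟩⟩
    · intro m
      obtain ⟨a, rfl⟩ := hζ m
      exact ⟨ι a, a8 a⟩
    · intro x; rw [a5]; simp [K]
    · intro x; rw [a3]; simp [K]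
    · intro j x; rw [a4]; simp [K]
    · intro i hi x hx _ _
      rw [a2 i (by exact_mod_cast hi)] at hx
      exact ⟨0, by simp [← hx]⟩
  | succ n ih =>
    obtain ⟨S⟩ := ih
    let Z : Submodule Q S.X := LinearMap.ker S.K.d ⊓ LinearMap.ker S.ε ⊓ 
      LinearMap.ker (S.K.p n - LinearMap.id)
    have : Module.Finite Q Z := inferInstance
    obtain ⟨k, ζ, hζ⟩ := Module.Finite.exists_fin' Q Z
    have hZ : ∀ z : Z, S.K.d z = 0 ∧ S.ε z = 0 ∧ S.K.p n z = z := by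
      rintro ⟨z, ⟨h1, h2⟩, h3⟩
      refine ⟨h1, h2, ?_⟩
      simpa [sub_eq_zero] using h3
    obtain ⟨Y, _, _, _, _, L, g, ι, a1, a2, a3, a4, a5, a6, a7, a8, a9⟩ :=
      KMod.cell n (Z.subtype ∘ₗ ζ) S.ε c f S.K (fun a => (hZ (ζ a)).1) (fun a => (hZ (ζ a)).2.2)
        S.εe (fun a => (hZ (ζ a)).2.1)
    refine ⟨⟨S.X × Y, S.K.cone L n g a4 a5, S.ε ∘ₗ LinearMap.fst Q S.X Y, ?_, ?_, ?_, ?_, ?_, ?_, ?_⟩⟩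
    · intro x; ext <;> simp [KMod.cone, S.dd, a1, a3]
    · intro i hi x
      ext
      · simp [KMod.cone, S.neg _ hi]
      · have : i - n - 1 < 0 := by lia
        simp [KMod.cone, a2 _ this]
    · intro m
      obtain ⟨x, rfl⟩ := S.surj m
      exact ⟨(x, 0), rfl⟩
    · intro x; simp [KMod.cone, S.εp]
    · intro x; simp [KMod.cone, S.εd, a9]
    · intro j x; simp [KMod.cone, S.εe]
    · rintro i hi ⟨x, y⟩ hx hdx hεx
      have hy : y = 0 := by
        have := congrArg Prod.snd hx
        simp only [KMod.cone, LinearMap.prodMap_apply] at this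
        rw [← this]; exact a2 _ (by push_cast at hi; lia) _
      subst hy
      have hx1 : S.K.p i x = x := congrArg Prod.fst hx
      have hdx1 : S.K.d x = 0 := by simpa [KMod.cone] using congrArg Prod.fst hdx
      have hεx1 : S.ε x = 0 := hεx
      by_cases hin : i < n
      · obtain ⟨w, hw⟩ := S.exact i hin x hx1 hdx1 hεx1
        refine ⟨(w, 0), ?_⟩
        simp [KMod.cone, hw]
      · have : i = n := by push_cast at hi; lia
        subst this
        obtain ⟨a, ha⟩ := hζ ⟨x, ⟨⟨hdx1, hεx1⟩, by simp [hx1]⟩⟩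
        refine ⟨(0, ι a), ?_⟩
        have h0 : (n : ℤ) + 1 - n - 1 = 0 := by ring
        simp [KMod.cone, h0, a6, a7, a8, ha]

open CategoryTheory

theorem pd_of_ext {Q : Type} [CommRing Q] (M : Type) [AddCommGroup M] [Module Q M] (n : ℕ)
    (h : ∀ (L : Type) [AddCommGroup L] [Module Q L], ∀ i : ℕ, n < i →
      Subsingleton (extAP Q M L i)) :
    HasProjectiveDimensionLT (ModuleCat.of Q M) (n + 1) := by
  have : HasExt.{0} (ModuleCat.{0} Q) := inferInstance
  refine HasProjectiveDimensionLT.mk (fun i hi Y e => ?_)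
  let P := projectiveResolution (ModuleCat.of Q M)
  obtain ⟨φ, hφ, rfl⟩ := P.extMk_surjective e (i + 1) rfl
  obtain ⟨j, rfl⟩ : ∃ j, i = j + 1 := ⟨i - 1, by lia⟩
  rw [P.extMk_eq_zero_iff φ _ rfl hφ j rfl]
  have hs := h Y (j + 1) (by lia)
  have hz : Limits.IsZero ((P.complex.linearYonedaObj Q Y).homology (j + 1)) := by
    refine Limits.IsZero.of_iso ?_ (P.isoExt (R := Q) (j + 1) Y).symm
    exact @ModuleCat.isZero_of_subsingleton _ _ _ hs
  rw [← HomologicalComplex.exactAt_iff_isZero_homology,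
    HomologicalComplex.exactAt_iff' _ j (j + 1) (j + 2) (by simp) (by simp),
    ShortComplex.moduleCat_exact_iff] at hz
  obtain ⟨g, hg⟩ := hz φ hφ
  exact ⟨g, hg⟩

theorem pd_step {Q : Type} [CommRing Q] {A B C : Type} [AddCommGroup A] [Module Q A]
    [AddCommGroup B] [Module Q B] [AddCommGroup C] [Module Q C] [Module.Projective Q B]
    (f : A →ₗ[Q] B) (g : B →ₗ[Q] C) (hf : Function.Injective f) (hg : Function.Surjective g)
    (hfg : ∀ b, g b = 0 ↔ ∃ a, f a = b) (n : ℕ)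
    (h : HasProjectiveDimensionLT (ModuleCat.of Q C) (n + 2)) :
    HasProjectiveDimensionLT (ModuleCat.of Q A) (n + 1) := by
  let S : ShortComplex (ModuleCat.{0} Q) := ShortComplex.moduleCatMk f g (by
    ext a; exact (hfg _).2 ⟨a, rfl⟩)
  have hS : S.ShortExact :=
    { exact := by
        rw [ShortComplex.moduleCat_exact_iff]
        intro x hx
        exact (hfg x).1 hx
      mono_f := (ModuleCat.mono_iff_injective _).2 hf
      epi_g := (ModuleCat.epi_iff_surjective _).2 hg }
  have hp : Projective (ModuleCat.of Q B) := inferInstance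
  have : HasProjectiveDimensionLT S.X₂ (n + 1) :=
    hasProjectiveDimensionLT_of_ge (ModuleCat.of Q B) 1 (n + 1) (by lia)
  exact hS.hasProjectiveDimensionLT_X₁ (n + 1) this h

open CategoryTheory

section
variable {Q : Type} [CommRing Q] {c : ℕ} {f : Fin c → Q} {M : Type} [AddCommGroup M] [Module Q M]

theorem proj_range {A X : Type} [CommRing A] [AddCommGroup X] [Module A X] [Module.Projective A X]
    (p : X →ₗ[A] X) (hp : ∀ x, p (p x) = p x) : Module.Projective A (LinearMap.range p) := by
  refine Module.Projective.of_split (LinearMap.range p).subtype p.rangeRestrict ?_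
  ext ⟨x, y, rfl⟩
  simp [hp]

/-- boundaries coming from degree `i` -/
def Stage.Bd {n : ℤ} (S : Stage f M n) (i : ℤ) : Submodule Q S.X :=
  (LinearMap.range (S.K.p i)).map S.K.d

theorem Stage.pd {n : ℤ} (S : Stage f M n) (N : ℕ) (hN : (N : ℤ) < n)
    (h : HasProjectiveDimensionLT (ModuleCat.of Q M) (N + 1)) (i : ℕ) : i < N → 
    HasProjectiveDimensionLT (ModuleCat.of Q (S.Bd (i + 1))) (N - i) := by
  induction i with
  | zero =>
    intro hi
    obtain ⟨m, rfl⟩ : ∃ m, N = m + 1 := ⟨N - 1, by lia⟩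
    have := proj_range (S.K.p 0) (S.K.pp 0)
    have hle : ∀ x ∈ S.Bd ((0 : ℕ) + 1), x ∈ LinearMap.range (S.K.p 0) := by
      rintro _ ⟨_, ⟨y, rfl⟩, rfl⟩
      rw [S.K.dp]; simp
    refine pd_step (Submodule.inclusion hle) (S.ε ∘ₗ (LinearMap.range (S.K.p 0)).subtype)
      (Submodule.inclusion_injective hle) ?_ ?_ m h
    · intro m
      obtain ⟨x, rfl⟩ := S.surj m
      exact ⟨⟨S.K.p 0 x, x, rfl⟩, S.εp x⟩
    · rintro ⟨_, y, rfl⟩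
      constructor
      · intro hy
        have hy' : S.ε (S.K.p 0 y) = 0 := hy
        obtain ⟨w, hw⟩ := S.exact 0 (by lia) _ (S.K.pp 0 y) (by rw [S.K.dp]; exact S.neg _ (by lia) _) hy'
        exact ⟨⟨S.K.p 0 y, _, ⟨w, rfl⟩, by simpa using hw⟩, rfl⟩
      · rintro ⟨⟨_, z, hz, rfl⟩, hw⟩
        rw [← hw]
        exact S.εd z
  | succ i ih =>
    intro hi
    obtain ⟨m, rfl⟩ : ∃ m, N = m + i + 2 := ⟨N - i - 2, by lia⟩
    have h' := ih (by lia)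
    rw [show m + i + 2 - i = m + 2 by lia] at h'
    rw [show m + i + 2 - (i + 1) = m + 1 by lia]
    push_cast
    have := proj_range (S.K.p (i + 1)) (S.K.pp _)
    have hle : ∀ x ∈ S.Bd (i + 1 + 1), x ∈ LinearMap.range (S.K.p (i + 1)) := by
      rintro _ ⟨_, ⟨y, rfl⟩, rfl⟩
      rw [S.K.dp]; simp
    refine pd_step (Submodule.inclusion hle) ((S.K.d).restrict (q := S.Bd (i + 1))
      (fun x hx => Submodule.mem_map_of_mem hx))
      (Submodule.inclusion_injective hle) ?_ ?_ m h'
    · rintro ⟨_, x, hx, rfl⟩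
      exact ⟨⟨x, hx⟩, rfl⟩
    · rintro ⟨_, y, rfl⟩
      constructor
      · intro hy
        have hy' : S.K.d (S.K.p (i + 1) y) = 0 := congrArg Subtype.val hy
        obtain ⟨w, hw⟩ := S.exact (i + 1) (by push_cast at hN; lia) _ (S.K.pp _ y) hy' (by 
          rw [← S.εp, S.K.orth _ _ _ (by lia)]; simp)
        exact ⟨⟨S.K.p (i + 1) y, _, ⟨w, rfl⟩, hw⟩, rfl⟩
      · rintro ⟨⟨_, z, hz, rfl⟩, hw⟩
        rw [← hw]
        exact Subtype.ext (S.dd z)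

theorem Stage.split {n : ℤ} (S : Stage f M n) (N : ℕ) (h0 : 0 < N) (hN : (N : ℤ) < n)
    (h : HasProjectiveDimensionLT (ModuleCat.of Q M) (N + 1)) :
    ∃ s : S.X →ₗ[Q] S.X, ∀ x, S.K.d (s x) = S.K.d (S.K.p N x) ∧ S.K.p N (s x) = s x ∧
      (S.K.d (S.K.p N x) = 0 → s x = 0) := by
  obtain ⟨m, rfl⟩ : ∃ m, N = m + 1 := ⟨N - 1, by lia⟩
  have h1 := S.pd (m + 1) hN h m (by lia)
  rw [show m + 1 - m = 1 by lia, ← projective_iff_hasProjectiveDimensionLT_one] at h1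
  rw [show ((m : ℤ) + 1) = ((m + 1 : ℕ) : ℤ) by simp] at h1
  have h2 : Module.Projective Q (S.Bd (m + 1 : ℕ)) :=
    ModuleCat.projective_of_module_projective (ModuleCat.of Q (S.Bd (m + 1 : ℕ)))
  let g : LinearMap.range (S.K.p (m + 1 : ℕ)) →ₗ[Q] S.Bd (m + 1 : ℕ) := (S.K.d).restrict
    (q := S.Bd (m + 1 : ℕ)) (fun x hx => Submodule.mem_map_of_mem hx)
  have hg : Function.Surjective g := by
    rintro ⟨_, x, hx, rfl⟩
    exact ⟨⟨x, hx⟩, rfl⟩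
  obtain ⟨t, ht⟩ := Module.projective_lifting_property g LinearMap.id hg
  refine ⟨(LinearMap.range _).subtype ∘ₗ t ∘ₗ g ∘ₗ (S.K.p (m + 1 : ℕ)).rangeRestrict, fun x => ⟨?_, ?_, ?_⟩⟩
  · have := LinearMap.congr_fun ht (g ((S.K.p (m + 1 : ℕ)).rangeRestrict x))
    exact congrArg Subtype.val this
  · obtain ⟨y, hy⟩ := (t (g ((S.K.p (m + 1 : ℕ)).rangeRestrict x))).2
    simp only [LinearMap.comp_apply, Submodule.subtype_apply]
    rw [← hy, S.K.pp]
  · intro hx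
    have : g ((S.K.p (m + 1 : ℕ)).rangeRestrict x) = 0 := Subtype.ext hx
    simp only [LinearMap.comp_apply]; rw [this]; simp
end

/-- The main inductive object. -/
structure Tower {Q : Type} [CommRing Q] {c : ℕ} (f : Fin c → Q) (J : Ideal Q) (M : Type)
    [AddCommGroup M] [Module Q M] (N : ℤ) (s : ℕ) where
  X : Type
  [i1 : AddCommGroup X]
  [i2 : Module Q X]
  [proj : Module.Projective Q X]
  K : KMod f X
  fg : ∀ i, (LinearMap.range (K.p i)).FG
  ε : X →ₗ[Q] M
  dd : ∀ x, K.d (K.d x) ∈ J • (⊤ : Submodule Q X)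
  neg : ∀ i < 0, ∀ x, K.p i x = 0
  surj : Function.Surjective ε
  εp : ∀ x, ε (K.p 0 x) = ε x
  εd : ∀ x, ε (K.d x) = 0
  εe : ∀ j x, ε (K.e j x) = 0
  exact : ∀ x, K.d x ∈ J • (⊤ : Submodule Q X) → ε x = 0 →
    ∃ y, x - K.d y ∈ J • (⊤ : Submodule Q X)
  t : Fin s → X →ₗ[Q] X
  σ : Fin s → X →ₗ[Q] X
  tp : ∀ j i x, t j (K.p i x) = K.p (i - 2) (t j x)
  σp : ∀ j i x, σ j (K.p i x) = K.p (i + 2) (σ j x)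
  td : ∀ j x, t j (K.d x) = K.d (t j x)
  te : ∀ j k x, t j (K.e k x) = K.e k (t j x)
  tt : ∀ j k x, t j (t k x) = t k (t j x)
  cogen : ∀ i > N, ∀ x, ∑ j, σ j (t j (K.p i x)) = K.p i x

attribute [instance] Tower.i1 Tower.i2 Tower.proj

theorem exists_tower_zero {Q : Type} [CommRing Q] [IsNoetherianRing Q] {c : ℕ} {f : Fin c → Q}
    {M : Type} [AddCommGroup M] [Module Q M] (N : ℕ) (h0 : 0 < N)
    (S : Stage f M (N + 1 : ℕ)) 
    (h : HasProjectiveDimensionLT (ModuleCat.of Q M) (N + 1)) :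
    Nonempty (Tower f ⊥ M N 0) := by
  classical
  obtain ⟨s, hs⟩ := S.split N h0 (by push_cast; lia) h
  let K := S.K
  let L : Submodule Q S.X := 
    { carrier := {x | (∀ i < (N : ℤ), K.p i x = 0) ∧ K.d (K.p N x) = 0}
      add_mem' := fun {a b} ha hb => ⟨fun i hi => by simp [ha.1 i hi, hb.1 i hi], by simp [ha.2, hb.2]⟩
      zero_mem' := by simp
      smul_mem' := fun q x hx => ⟨fun i hi => by simp [hx.1 i hi], by simp [hx.2]⟩ }
  have hL : ∀ x, x ∈ L ↔ (∀ i < (N : ℤ), K.p i x = 0) ∧ K.d (K.p N x) = 0 := fun x => Iff.rfl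
  have Ld : L ≤ L.comap K.d := by
    intro x hx
    refine ⟨fun i hi => ?_, ?_⟩
    · rw [show i = (i + 1) - 1 by ring, ← K.dp]
      by_cases hi' : i + 1 < N
      · rw [hx.1 _ hi']; simp
      · rw [show i + 1 = N by lia]; exact hx.2
    · rw [show (N : ℤ) = (N + 1) - 1 by ring, ← K.dp, S.dd]
  have Le : ∀ j, L ≤ L.comap (K.e j) := by
    intro j x hx
    have key : ∀ i ≤ (N : ℤ), K.p i (K.e j x) = 0 := by
      intro i hi
      rw [show i = (i - 1) + 1 by ring, ← K.ep, hx.1 _ (by lia)]; simp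
    exact ⟨fun i hi => key i hi.le, by rw [key _ le_rfl]; simp⟩
  have Lp : ∀ i, L ≤ L.comap (K.p i) := by
    intro i x hx
    refine ⟨fun j hj => ?_, ?_⟩
    · by_cases hij : j = i
      · subst hij; rw [K.pp, hx.1 _ hj]
      · exact K.orth _ _ _ hij
    · by_cases hij : (N : ℤ) = i
      · subst hij; rw [K.pp, hx.2]
      · rw [K.orth _ _ _ hij]; simp
  have Lε : L ≤ LinearMap.ker S.ε := by
    intro x hx
    rw [LinearMap.mem_ker, ← S.εp, hx.1 0 (by exact_mod_cast h0)]; simp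
  let θ : S.X →ₗ[Q] S.X := (∑ i ∈ Finset.range N, K.p (i : ℕ)) + s
  have pθ : ∀ x, ∀ i < (N : ℤ), K.p i (θ x) = K.p i x := by
    intro x i hi
    have h1 : K.p i (s x) = 0 := by
      rw [← (hs x).2.1]; exact K.orth _ _ _ hi.ne
    simp only [θ, LinearMap.add_apply, LinearMap.sum_apply, map_add, map_sum, h1, add_zero]
    by_cases hi0 : i < 0
    · rw [S.neg i hi0]; exact Finset.sum_eq_zero (fun j _ => S.neg i hi0 _)
    · obtain ⟨k, rfl⟩ := Int.eq_ofNat_of_zero_le (not_lt.1 hi0)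
      rw [Finset.sum_eq_single k]
      · exact K.pp _ _
      · intro b _ hb; exact K.orth _ _ _ (by exact_mod_cast hb.symm)
      · intro hk; exact absurd (Finset.mem_range.2 (by exact_mod_cast hi)) hk
  have pNθ : ∀ x, K.p N (θ x) = s x := by
    intro x
    simp only [θ, LinearMap.add_apply, LinearMap.sum_apply, map_add, map_sum, K, (hs x).2.1]
    rw [Finset.sum_eq_zero, zero_add]
    intro i hi
    refine S.K.orth _ _ _ ?_
    have := Finset.mem_range.1 hi
    lia
  have Lθ : ∀ x, x - θ x ∈ L := by
    intro x
    refine ⟨fun i hi => by simp [pθ x i hi], ?_⟩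
    rw [map_sub, pNθ, map_sub, (hs x).1, sub_self]
  have kθ : L ≤ LinearMap.ker θ := by
    intro x hx
    simp only [θ, LinearMap.mem_ker, LinearMap.add_apply, LinearMap.sum_apply]
    rw [(hs x).2.2 hx.2, add_zero]
    exact Finset.sum_eq_zero fun i hi => hx.1 _ (by simpa using hi)
  have hproj : Module.Projective Q (S.X ⧸ L) := by
    refine Module.Projective.of_split (L.liftQ θ kθ) L.mkQ ?_
    apply Submodule.linearMap_qext
    ext x
    simpa using ((Submodule.Quotient.eq L).2 (Lθ x)).symm
  have ind : ∀ {P : S.X ⧸ L → Prop}, (∀ x, P (L.mkQ x)) → ∀ y, P y := by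
    intro P h y
    obtain ⟨x, rfl⟩ := L.mkQ_surjective y
    exact h x
  let K' : KMod f (S.X ⧸ L) :=
    { p := fun i => L.mapQ L (K.p i) (Lp i)
      d := L.mapQ L K.d Ld
      e := fun j => L.mapQ L (K.e j) (Le j)
      pp := fun i => ind fun x => by simp [K.pp]
      orth := fun i j y h => by
        revert y; exact ind fun x => by simp [K.orth _ _ _ h]
      dp := fun i => ind fun x => by simp [K.dp]
      ep := fun j i => ind fun x => by simp [K.ep]
      de := fun j => ind fun x => by 
        have := K.de j x
        simp only [Submodule.mkQ_apply, Submodule.mapQ_apply, ← Submodule.Quotient.mk_add,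
          ← Submodule.Quotient.mk_smul, this]
      ee := fun i j => ind fun x => by 
        have := K.ee i j x
        simp only [Submodule.mkQ_apply, Submodule.mapQ_apply, ← Submodule.Quotient.mk_add, this]
        simp
      esq := fun i => ind fun x => by simp [K.esq] }
  refine ⟨⟨S.X ⧸ L, K', fun i => IsNoetherian.noetherian _, L.liftQ S.ε Lε, ?_, ?_, ?_, ?_, ?_, ?_, ?_,
    fun j => j.elim0, fun j => j.elim0, fun j => j.elim0, fun j => j.elim0, fun j => j.elim0,
    fun j => j.elim0, fun j => j.elim0, ?_⟩⟩
  · exact ind fun x => by simp [K', K, S.dd]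
  · intro i hi
    exact ind fun x => by simp [K', K, S.neg i hi]
  · intro m
    obtain ⟨x, rfl⟩ := S.surj m
    exact ⟨L.mkQ x, rfl⟩
  · exact ind fun x => S.εp x
  · exact ind fun x => S.εd x
  · intro j; exact ind fun x => S.εe j x
  · refine ind fun x => ?_
    intro h1 h2
    have h1' : K.d x ∈ L := by simpa [K'] using h1
    have h2' : S.ε x = 0 := h2
    have key : ∀ i ≤ (N : ℤ), K.d (K.p i x) = 0 := by
      intro i hi; rw [K.dp]; exact h1'.1 _ (by lia)
    have key2 : ∀ i < (N : ℤ) , ∃ y, K.d (K.p (i + 1) y) = K.p i x := by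
      intro i hi
      refine S.exact i (by push_cast; lia) _ (K.pp _ _) (key i hi.le) ?_
      by_cases hi0 : i = 0
      · subst hi0; rw [S.εp, h2']
      · rw [← S.εp, K.orth _ _ _ (Ne.symm hi0)]; simp
    choose! y hy using key2
    refine ⟨L.mkQ (∑ i ∈ Finset.range N, K.p ((i : ℤ) + 1) (y i)), ?_⟩
    have : x - K.d (∑ i ∈ Finset.range N, K.p ((i : ℤ) + 1) (y i)) ∈ L := by
      have hsum : ∑ i ∈ Finset.range N, K.d (K.p ((i : ℤ) + 1) (y i)) =
          ∑ i ∈ Finset.range N, K.p (i : ℤ) x :=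
        Finset.sum_congr rfl (fun i hi => hy (i : ℤ) (by exact_mod_cast Finset.mem_range.1 hi))
      rw [map_sum, hsum]
      have hsx : s x = 0 := (hs x).2.2 (key N le_rfl)
      have := Lθ x
      simpa [θ, hsx] using this
    rw [Submodule.bot_smul, Submodule.mem_bot]
    exact (Submodule.Quotient.mk_eq_zero L).2 this
  · intro i hi
    refine ind fun x => ?_
    have : K.p i x ∈ L := by
      refine ⟨fun j hj => K.orth _ _ _ (by lia), ?_⟩
      rw [K.orth _ _ _ hi.ne]; simp
    simp [K', (Submodule.Quotient.mk_eq_zero L).2 this]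

open CategoryTheory

section
variable {Q : Type} [CommRing Q]

theorem lin_mem {X Y : Type} [AddCommGroup X] [Module Q X] [AddCommGroup Y] [Module Q Y]
    (J : Ideal Q) (F : X →ₗ[Q] Y) {x : X} (h : x ∈ J • (⊤ : Submodule Q X)) :
    F x ∈ J • (⊤ : Submodule Q Y) := by
  have := Submodule.mem_map_of_mem (f := F) h
  rw [Submodule.map_smul''] at this
  exact Submodule.smul_mono le_rfl le_top this

theorem finsupp_mem {ι X : Type} [AddCommGroup X] [Module Q X] (J : Ideal Q) (x : ι →₀ X) :
    x ∈ J • (⊤ : Submodule Q (ι →₀ X)) ↔ ∀ k, x k ∈ J • (⊤ : Submodule Q X) := by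
  constructor
  · intro h k
    exact lin_mem J (Finsupp.lapply k) h
  · intro h
    rw [← Finsupp.sum_single x]
    exact Submodule.sum_mem _ fun k _ => lin_mem J (Finsupp.lsingle k) (h k)

theorem reg_proj {X : Type} [AddCommGroup X] [Module Q X] [Module.Projective Q X] (J : Ideal Q)
    (a : Q) (ha : ∀ q, a * q ∈ J → q ∈ J) (x : X) (h : a • x ∈ J • (⊤ : Submodule Q X)) :
    x ∈ J • (⊤ : Submodule Q X) := by
  obtain ⟨s, hs⟩ := (Module.projective_def' (R := Q) (P := X)).1 inferInstance
  have h1 := lin_mem J s h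
  have h2 : s x ∈ J • (⊤ : Submodule Q (X →₀ Q)) := by
    rw [finsupp_mem] at h1 ⊢
    intro k
    have := h1 k
    simp only [map_smul, Finsupp.smul_apply, smul_eq_mul, Ideal.mul_top] at this ⊢
    exact ha _ this
  have h3 := lin_mem J (Finsupp.linearCombination Q id) h2
  have h4 := LinearMap.congr_fun hs x
  simp only [LinearMap.comp_apply, LinearMap.id_apply] at h4
  rwa [h4] at h3

theorem mem_sup_span {X : Type} [AddCommGroup X] [Module Q X] (J : Ideal Q) (a : Q) (x : X) :
    x ∈ (J ⊔ Ideal.span {a}) • (⊤ : Submodule Q X) ↔ ∃ y, x - a • y ∈ J • (⊤ : Submodule Q X) := by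
  rw [Submodule.sup_smul, Submodule.mem_sup]
  constructor
  · rintro ⟨u, hu, v, hv, rfl⟩
    rw [Submodule.ideal_span_singleton_smul] at hv
    obtain ⟨y, -, rfl⟩ := hv
    exact ⟨y, by simpa using hu⟩
  · rintro ⟨y, hy⟩
    refine ⟨_, hy, a • y, ?_, by simp⟩
    exact Submodule.smul_mem_smul (Ideal.mem_span_singleton_self a) trivial

variable {X : Type} [AddCommGroup X] [Module Q X]

/-- apply `F k` to the `k`-th coefficient -/
noncomputable def coef (F : ℕ → X →ₗ[Q] X) : (ℕ →₀ X) →ₗ[Q] (ℕ →₀ X) :=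
  Finsupp.lsum Q (fun k => Finsupp.lsingle k ∘ₗ F k)

@[simp] theorem coef_apply (F : ℕ → X →ₗ[Q] X) (x : ℕ →₀ X) (k : ℕ) : coef F x k = F k (x k) := by
  classical
  induction x using Finsupp.induction_linear with
  | zero => simp
  | add a b ha hb => simp [ha, hb]
  | single i a =>
    simp only [coef, Finsupp.lsum_single, LinearMap.comp_apply, Finsupp.lsingle_apply, Finsupp.single_apply]
    split_ifs with h
    · rw [h]
    · simp

/-- shift down -/
noncomputable def sdown : (ℕ →₀ X) →ₗ[Q] (ℕ →₀ X) :=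
  Finsupp.lcomapDomain Nat.succ Nat.succ_injective

@[simp] theorem sdown_apply (x : ℕ →₀ X) (k : ℕ) : sdown (Q := Q) x k = x (k + 1) := rfl

/-- shift up -/
noncomputable def sup' : (ℕ →₀ X) →ₗ[Q] (ℕ →₀ X) := Finsupp.lmapDomain X Q Nat.succ

@[simp] theorem sup'_zero (x : ℕ →₀ X) : sup' (Q := Q) x 0 = 0 := 
  Finsupp.mapDomain_of_notMem_range _ _ (by simp)

@[simp] theorem sup'_succ (x : ℕ →₀ X) (k : ℕ) : sup' (Q := Q) x (k + 1) = x k :=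
  Finsupp.mapDomain_apply Nat.succ_injective _ _

variable {c : ℕ} {f : Fin (c + 1) → Q}

/-- the Eisenbud-Shamash construction -/
noncomputable def KMod.shamash (K : KMod f X) : KMod (fun j : Fin c => f j.succ) (ℕ →₀ X) where
  p := fun i => coef fun k => K.p (i - 2 * k)
  d := coef (fun _ => K.d) + coef (fun _ => K.e 0) ∘ₗ sdown
  e := fun j => coef fun _ => K.e j.succ
  pp := fun i x => by ext k; simp [K.pp]
  orth := fun i j x h => by
    ext k; simp only [coef_apply, Finsupp.coe_zero, Pi.zero_apply]; exact K.orth _ _ _ (by lia)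
  dp := fun i x => by
    ext k
    simp only [LinearMap.add_apply, Finsupp.add_apply, LinearMap.comp_apply, coef_apply, sdown_apply,
      map_add, K.dp, K.ep]
    congr 3
    · ring
    · push_cast; ring
  ep := fun j i x => by
    ext k
    simp only [coef_apply, K.ep]
    congr 2
    ring
  de := fun j x => by
    ext k
    have h1 := K.de j.succ (x k)
    have h2 := K.ee 0 j.succ (x (k + 1))
    simp only [LinearMap.add_apply, Finsupp.add_apply, LinearMap.comp_apply, coef_apply, sdown_apply,
      map_add, Finsupp.smul_apply]
    rw [← h1, ← sub_eq_zero, ← h2]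
    abel
  ee := fun i j x => by ext k; simp [K.ee]
  esq := fun i x => by ext k; simp [K.esq]

theorem KMod.shamash_d (K : KMod f X) (x : ℕ →₀ X) (k : ℕ) :
    K.shamash.d x k = K.d (x k) + K.e 0 (x (k + 1)) := by
  simp [KMod.shamash]

theorem KMod.shamash_p (K : KMod f X) (x : ℕ →₀ X) (i : ℤ) (k : ℕ) :
    K.shamash.p i x k = K.p (i - 2 * k) (x k) := by
  simp [KMod.shamash]

theorem KMod.shamash_e (K : KMod f X) (x : ℕ →₀ X) (j) (k : ℕ) :
    K.shamash.e j x k = K.e j.succ (x k) := by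
  simp [KMod.shamash]

theorem Tower.step_exact {J : Ideal Q} {M : Type} [AddCommGroup M] [Module Q M] {N : ℤ} {s : ℕ}
    (T : Tower f J M N s) (hf : ∀ q, f 0 * q ∈ J → q ∈ J) 
    (hdd : ∀ x, T.K.shamash.d (T.K.shamash.d x) ∈ (J ⊔ Ideal.span {f 0}) • (⊤ : Submodule Q (ℕ →₀ T.X)))
    (m : ℕ) : ∀ x : ℕ →₀ T.X,
    T.K.shamash.d x ∈ (J ⊔ Ideal.span {f 0}) • (⊤ : Submodule Q (ℕ →₀ T.X)) → T.ε (x 0) = 0 →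
    (∀ k ≥ m, x k ∈ (J ⊔ Ideal.span {f 0}) • (⊤ : Submodule Q T.X)) →
    ∃ y, x - T.K.shamash.d y ∈ (J ⊔ Ideal.span {f 0}) • (⊤ : Submodule Q (ℕ →₀ T.X)) := by
  classical
  induction m with
  | zero =>
    intro x _ _ h
    exact ⟨0, by simpa [finsupp_mem] using h⟩
  | succ m ih =>
    intro x hx hε h
    have hle : J • (⊤ : Submodule Q T.X) ≤ (J ⊔ Ideal.span {f 0}) • (⊤ : Submodule Q T.X) :=
      Submodule.smul_mono le_sup_left le_rfl
    have hx' := fun k => (finsupp_mem _ _).1 hx k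
    simp only [KMod.shamash_d] at hx'
    have h1 : T.K.d (x m) ∈ (J ⊔ Ideal.span {f 0}) • (⊤ : Submodule Q T.X) := by
      have := Submodule.sub_mem _ (hx' m) (lin_mem _ (T.K.e 0) (h (m + 1) le_rfl))
      simpa using this
    obtain ⟨y, hy⟩ := (mem_sup_span _ _ _).1 h1
    have hdy : T.K.d y ∈ J • (⊤ : Submodule Q T.X) := by
      refine reg_proj J (f 0) hf _ ?_
      have := Submodule.sub_mem _ (T.dd (x m)) (lin_mem _ T.K.d hy)
      simpa using this
    have hw : ∃ w, x m - T.K.e 0 y - T.K.d w ∈ J • (⊤ : Submodule Q T.X) := by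
      cases m with
      | zero =>
        refine T.exact (x 0 - T.K.e 0 y) ?_ ?_
        · have := Submodule.add_mem _ hy (lin_mem _ (T.K.e 0) hdy)
          rw [← T.K.de] at this
          convert this using 1
          rw [map_sub]; abel
        · rw [map_sub, hε, T.εe, sub_zero]
      | succ m =>
        obtain ⟨w, hw⟩ := (mem_sup_span _ _ _).1 (hx' m)
        refine ⟨w, reg_proj J (f 0) hf _ ?_⟩
        have h2 := lin_mem _ T.K.d hw
        have h3 := lin_mem _ (T.K.e 0) hy
        have h4 := Submodule.add_mem _ (Submodule.sub_mem _ h2 (T.dd (x m))) h3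
        convert h4 using 1
        have := T.K.de 0 (x (m + 1))
        simp only [map_sub, map_add, map_smul, smul_sub]
        rw [← this]
        abel
    obtain ⟨w, hw⟩ := hw
    let z : ℕ →₀ T.X := Finsupp.single m w + Finsupp.single (m + 1) y
    obtain ⟨y', hy'⟩ := ih (x - T.K.shamash.d z) (by
        rw [map_sub]; exact Submodule.sub_mem _ hx (hdd z)) (by
        rw [Finsupp.sub_apply, KMod.shamash_d, map_sub, map_add, T.εd, T.εe, hε]; simp) (by
        intro k hk
        rw [Finsupp.sub_apply, KMod.shamash_d]
        rcases eq_or_lt_of_le hk with rfl | hk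
        · refine hle ?_
          convert hw using 1
          simp [z, Finsupp.single_apply]
          abel
        rcases eq_or_lt_of_le (Nat.succ_le_of_lt hk) with rfl | hk'
        · have := Submodule.sub_mem _ (h (m + 1) le_rfl) (hle hdy)
          have e0 : ¬ (m = m + 1 + 1) := by lia
          simpa [z, Finsupp.single_apply, e0] using this
        · have := h k hk
          have e1 : z k = 0 := by
            simp [z, Finsupp.single_apply]
            rw [if_neg (by lia), if_neg (by lia)]; simp
          have e2 : z (k + 1) = 0 := by
            simp [z, Finsupp.single_apply]
            rw [if_neg (by lia), if_neg (by lia)]; simp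
          simpa [e1, e2] using this)
    refine ⟨z + y', ?_⟩
    rwa [map_add, ← sub_sub]

theorem Tower.step [IsNoetherianRing Q] {J : Ideal Q} {M : Type} [AddCommGroup M] [Module Q M] {N : ℤ} {s : ℕ}
    (T : Tower f J M N s) (hf : ∀ q, f 0 * q ∈ J → q ∈ J) :
    Nonempty (Tower (fun j : Fin c => f j.succ) (J ⊔ Ideal.span {f 0}) M N (s + 1)) := by
  classical
  have hle : J • (⊤ : Submodule Q T.X) ≤ (J ⊔ Ideal.span {f 0}) • (⊤ : Submodule Q T.X) :=
      Submodule.smul_mono le_sup_left le_rfl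
  have hdd : ∀ x, T.K.shamash.d (T.K.shamash.d x) ∈
      (J ⊔ Ideal.span {f 0}) • (⊤ : Submodule Q (ℕ →₀ T.X)) := by
    intro x
    rw [finsupp_mem]
    intro k
    simp only [KMod.shamash_d, map_add, T.K.esq, add_zero]
    rw [add_assoc, T.K.de]
    exact Submodule.add_mem _ (hle (T.dd _)) (Submodule.smul_mem_smul 
      (Ideal.mem_sup_right (Ideal.mem_span_singleton_self _)) trivial)
  have hpr : Module.Projective Q (ℕ →₀ T.X) := by
    obtain ⟨s, hs⟩ := (Module.projective_def' (R := Q) (P := T.X)).1 inferInstance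
    have hfree : Module.Projective Q (ℕ →₀ (T.X →₀ Q)) :=
      Module.Projective.of_equiv (Finsupp.curryLinearEquiv Q (α := ℕ) (β := T.X) (M := Q))
    refine Module.Projective.of_split (Finsupp.mapRange.linearMap s)
      (Finsupp.mapRange.linearMap (Finsupp.linearCombination Q id)) ?_
    rw [← Finsupp.mapRange.linearMap_comp, hs]; simp
  refine ⟨{ X := ℕ →₀ T.X
            K := T.K.shamash
            fg := ?_
            ε := T.ε ∘ₗ Finsupp.lapply 0
            dd := hdd
            neg := ?_
            surj := ?_
            εp := ?_
            εd := ?_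
            εe := ?_
            exact := ?_
            t := Fin.cons sdown (fun j => coef fun _ => T.t j)
            σ := Fin.cons sup' (fun j => Finsupp.lsingle 0 ∘ₗ T.σ j ∘ₗ Finsupp.lapply 0)
            tp := ?_
            σp := ?_
            td := ?_
            te := ?_
            tt := ?_
            cogen := ?_ }⟩
  · intro i
    refine Submodule.FG.of_le (Submodule.fg_biSup (Finset.range (i.toNat + 1)) 
      (fun k => (LinearMap.range (T.K.p (i - 2 * k))).map (Finsupp.lsingle k))
      (fun k _ => (T.fg _).map _)) ?_
    rintro _ ⟨x, rfl⟩
    rw [← Finsupp.sum_single (T.K.shamash.p i x)]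
    refine Submodule.sum_mem _ fun k hk => ?_
    rw [KMod.shamash_p]
    by_cases hk' : k < i.toNat + 1
    · refine Submodule.mem_iSup_of_mem k (Submodule.mem_iSup_of_mem (Finset.mem_range.2 hk') ?_)
      exact Submodule.mem_map_of_mem ⟨_, rfl⟩
    · rw [T.neg _ (by lia)]; simp
  · intro i hi x
    ext k
    rw [KMod.shamash_p, T.neg _ (by lia)]; simp
  · intro m
    obtain ⟨x, rfl⟩ := T.surj m
    exact ⟨Finsupp.single 0 x, by simp⟩
  · intro x
    simp [KMod.shamash_p, T.εp]
  · intro x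
    simp [KMod.shamash_d, T.εd, T.εe]
  · intro j x
    simp [KMod.shamash_e, T.εe]
  · intro x hx hε
    refine T.step_exact hf hdd (x.support.sup id + 1) x hx hε ?_
    intro k hk
    have : x k = 0 := by
      by_contra h
      have := Finset.le_sup (f := id) (Finsupp.mem_support_iff.2 h)
      simp only [id] at this
      lia
    rw [this]; simp
  · intro j i x
    ext k
    rw [KMod.shamash_p]
    refine Fin.cases ?_ (fun j => ?_) j
    · simp only [Fin.cons_zero, sdown_apply, KMod.shamash_p]
      congr 2; push_cast; ring
    · simp only [Fin.cons_succ, coef_apply, KMod.shamash_p, T.tp]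
      congr 2; ring
  · intro j i x
    ext k
    rw [KMod.shamash_p]
    refine Fin.cases ?_ (fun j => ?_) j
    · simp only [Fin.cons_zero]
      cases k with
      | zero => simp
      | succ k =>
        simp only [sup'_succ, KMod.shamash_p]
        congr 2; push_cast; ring
    · simp only [Fin.cons_succ, LinearMap.comp_apply, Finsupp.lapply_apply, Finsupp.lsingle_apply,
        KMod.shamash_p, T.σp]
      cases k with
      | zero => simp
      | succ k => simp [Finsupp.single_apply]
  · intro j x
    ext k
    refine Fin.cases ?_ (fun j => ?_) j
    · simp [KMod.shamash_d]
    · simp [KMod.shamash_d, T.td, T.te]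
  · intro j l x
    ext k
    refine Fin.cases ?_ (fun j => ?_) j
    · simp [KMod.shamash_e]
    · simp [KMod.shamash_e, T.te]
  · intro j l x
    ext k
    refine Fin.cases ?_ (fun j => ?_) j <;> refine Fin.cases ?_ (fun l => ?_) l
    · simp
    · simp
    · simp
    · simp [T.tt]
  · intro i hi x
    ext k
    rw [Fin.sum_univ_succ, Finsupp.add_apply, Finsupp.finset_sum_apply]
    simp only [Fin.cons_succ, Fin.cons_zero, LinearMap.comp_apply, Finsupp.lapply_apply, Finsupp.lsingle_apply]
    cases k with
    | zero =>
      have := T.cogen i hi (x 0)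
      simpa [KMod.shamash_p] using this
    | succ k => simp [Finsupp.single_apply]
end

theorem exists_tower {Q : Type} [CommRing Q] [IsNoetherianRing Q] {c : ℕ} : ∀ (f : Fin c → Q) (J : Ideal Q)
    {M : Type} [AddCommGroup M] [Module Q M] {N : ℤ} {s : ℕ} (_ : Tower f J M N s)
    (_ : ∀ k : Fin c, ∀ q, f k * q ∈ J ⊔ Ideal.span (f '' {j | j < k}) → q ∈ J ⊔ Ideal.span (f '' {j | j < k})),
    ∃ g : Fin 0 → Q, Nonempty (Tower g (J ⊔ Ideal.span (Set.range f)) M N (s + c)) := by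
  induction c with
  | zero =>
    intro f J M _ _ N s T _
    refine ⟨f, ?_⟩
    simp only [Set.range_eq_empty, Ideal.span_empty, sup_bot_eq, add_zero]
    exact ⟨T⟩
  | succ c ih =>
    intro f J M _ _ N s T h
    obtain ⟨T'⟩ := T.step (by
      have := h 0
      simpa using this)
    obtain ⟨g, ⟨T''⟩⟩ := ih _ _ T' (by
      intro k q
      have := h k.succ q
      have e : f '' {j | j < k.succ} = {f 0} ∪ (fun j : Fin c => f j.succ) '' {j | j < k} := by
        ext a
        simp only [Set.mem_image, Set.mem_ofPred_eq, Set.singleton_union, Set.mem_insert_iff]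
        constructor
        · rintro ⟨j, hj, rfl⟩
          revert hj
          refine Fin.cases (fun _ => Or.inl rfl) (fun j hj => Or.inr ⟨j, by simpa using hj, rfl⟩) j
        · rintro (rfl | ⟨j, hj, rfl⟩)
          · exact ⟨0, Fin.succ_pos _, rfl⟩
          · exact ⟨j.succ, by simpa using hj, rfl⟩
      rwa [e, Ideal.span_union, ← sup_assoc] at this)
    refine ⟨g, ?_⟩
    have e : Set.range f = {f 0} ∪ Set.range (fun j : Fin c => f j.succ) := by
      ext a
      simp [Fin.exists_fin_succ, eq_comm]
    rw [e, Ideal.span_union, ← sup_assoc, show s + (c + 1) = s + 1 + c by ring]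
    exact ⟨T''⟩

open CategoryTheory TensorProduct

/-- The resolution over `A` with its operators. -/
structure FPkg (A : Type) [CommRing A] (M : Type)
    [AddCommGroup M] [Module A M] (N : ℤ) (s : ℕ) where
  X : Type
  [i1 : AddCommGroup X]
  [i2 : Module A X]
  [proj : Module.Projective A X]
  p : ℤ → X →ₗ[A] X
  d : X →ₗ[A] X
  pp : ∀ i x, p i (p i x) = p i x
  orth : ∀ i j x, i ≠ j → p i (p j x) = 0
  dp : ∀ i x, d (p i x) = p (i - 1) (d x)
  fg : ∀ i, (LinearMap.range (p i)).FG
  ε : X →ₗ[A] M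
  dd : ∀ x, d (d x) = 0
  neg : ∀ i < 0, ∀ x, p i x = 0
  surj : Function.Surjective ε
  εp : ∀ x, ε (p 0 x) = ε x
  εd : ∀ x, ε (d x) = 0
  exact : ∀ x, d x = 0 → ε x = 0 → ∃ y, d y = x
  t : Fin s → X →ₗ[A] X
  σ : Fin s → X →ₗ[A] X
  tp : ∀ j i x, t j (p i x) = p (i - 2) (t j x)
  σp : ∀ j i x, σ j (p i x) = p (i + 2) (σ j x)
  td : ∀ j x, t j (d x) = d (t j x)
  tt : ∀ j k x, t j (t k x) = t k (t j x)
  cogen : ∀ i > N, ∀ x, ∑ j, σ j (t j (p i x)) = p i x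

attribute [instance] FPkg.i1 FPkg.i2 FPkg.proj

section
variable {Q : Type} [CommRing Q] {A : Type} [CommRing A] [Algebra Q A]

theorem tmul_surj (hsurj : Function.Surjective (algebraMap Q A)) {X : Type} [AddCommGroup X] [Module Q X] (z : A ⊗[Q] X) :
    ∃ x : X, (1 : A) ⊗ₜ[Q] x = z := by
  induction z with
  | zero => exact ⟨0, by simp⟩
  | tmul a x =>
    obtain ⟨q, rfl⟩ := hsurj a
    exact ⟨q • x, by rw [← TensorProduct.smul_tmul, Algebra.smul_def, mul_one]⟩
  | add a b ha hb =>
    obtain ⟨x, rfl⟩ := ha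
    obtain ⟨y, rfl⟩ := hb
    exact ⟨x + y, by rw [TensorProduct.tmul_add]⟩

theorem tmul_zero_iff (hsurj : Function.Surjective (algebraMap Q A)) {X : Type} [AddCommGroup X] [Module Q X] (x : X) :
    (1 : A) ⊗ₜ[Q] x = 0 ↔ x ∈ RingHom.ker (algebraMap Q A) • (⊤ : Submodule Q X) := by
  constructor
  · intro h
    have e := Ideal.quotientKerAlgEquivOfSurjective (f := Algebra.ofId Q A) hsurj
    have h2 := congrArg (LinearMap.rTensor X e.symm.toLinearMap) h
    simp only [LinearMap.rTensor_tmul, AlgEquiv.toLinearMap_apply, map_one, map_zero] at h2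
    have h3 : x ∈ LinearMap.ker (TensorProduct.mk Q (Q ⧸ RingHom.ker (Algebra.ofId Q A)) X 1) := h2
    rw [LinearMap.ker_tensorProductMk] at h3
    exact h3
  · intro h
    refine Submodule.smul_induction_on h ?_ ?_
    · intro r hr n _
      rw [← TensorProduct.smul_tmul, Algebra.smul_def, (RingHom.mem_ker).1 hr, zero_mul, TensorProduct.zero_tmul]
    · intro x y hx hy
      rw [TensorProduct.tmul_add, hx, hy, add_zero]

theorem Tower.toFPkg (hsurj : Function.Surjective (algebraMap Q A)) {M : Type} [AddCommGroup M] [Module A M] [Module Q M] [IsScalarTower Q A M]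
    {f : Fin 0 → Q} {N : ℤ} {s : ℕ} (T : Tower f (RingHom.ker (algebraMap Q A)) M N s) :
    Nonempty (FPkg A M N s) := by
  have ind : ∀ {P : A ⊗[Q] T.X → Prop}, (∀ x : T.X, P ((1 : A) ⊗ₜ[Q] x)) → ∀ y, P y := by
    intro P h y
    obtain ⟨x, rfl⟩ := tmul_surj hsurj y
    exact h x
  refine ⟨{ X := A ⊗[Q] T.X
            p := fun i => (T.K.p i).baseChange A
            d := T.K.d.baseChange A
            pp := fun i => ind fun x => by simp [T.K.pp]
            orth := fun i j y h => by
              revert y; exact ind fun x => by simp [T.K.orth _ _ _ h]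
            dp := fun i => ind fun x => by simp [T.K.dp]
            fg := ?_
            ε := T.ε.liftBaseChange A
            dd := ind fun x => by
              simp only [LinearMap.baseChange_tmul]
              exact (tmul_zero_iff hsurj _).2 (T.dd x)
            neg := fun i hi => ind fun x => by simp [T.neg i hi]
            surj := fun m => by
              obtain ⟨x, rfl⟩ := T.surj m
              exact ⟨(1 : A) ⊗ₜ[Q] x, by simp⟩
            εp := ind fun x => by simp [T.εp]
            εd := ind fun x => by simp [T.εd]
            exact := ind fun x => by
              intro h1 h2
              simp only [LinearMap.baseChange_tmul] at h1
              obtain ⟨y, hy⟩ := T.exact x ((tmul_zero_iff hsurj _).1 h1) (by simpa using h2)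
              refine ⟨(1 : A) ⊗ₜ[Q] y, ?_⟩
              have := (tmul_zero_iff hsurj _).2 hy
              rw [TensorProduct.tmul_sub, sub_eq_zero] at this
              simp [this]
            t := fun j => (T.t j).baseChange A
            σ := fun j => (T.σ j).baseChange A
            tp := fun j i => ind fun x => by simp [T.tp]
            σp := fun j i => ind fun x => by simp [T.σp]
            td := fun j => ind fun x => by simp [T.td]
            tt := fun j k => ind fun x => by simp [T.tt j k]
            cogen := fun i hi => ind fun x => by
              simp only [LinearMap.baseChange_tmul, ← TensorProduct.tmul_sum, T.cogen i hi] }⟩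
  intro i
  obtain ⟨S, hS⟩ := T.fg i
  classical
  refine ⟨S.image (fun x => (1 : A) ⊗ₜ[Q] x), le_antisymm ?_ ?_⟩
  · rw [Submodule.span_le]
    intro z hz
    simp only [Finset.coe_image, Set.mem_image] at hz
    obtain ⟨x, hx, rfl⟩ := hz
    obtain ⟨y, rfl⟩ : x ∈ LinearMap.range (T.K.p i) := hS ▸ Submodule.subset_span hx
    exact ⟨1 ⊗ₜ y, by simp⟩
  · rintro _ ⟨z, rfl⟩
    revert z
    refine ind fun x => ?_
    rw [LinearMap.baseChange_tmul]
    have hx : T.K.p i x ∈ Submodule.span Q (S : Set T.X) := hS ▸ ⟨x, rfl⟩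
    generalize T.K.p i x = w at hx
    induction hx using Submodule.span_induction with
    | mem w hw => exact Submodule.subset_span (by simpa using ⟨w, hw, rfl⟩)
    | zero => simp
    | add a b _ _ ha hb => rw [TensorProduct.tmul_add]; exact Submodule.add_mem _ ha hb
    | smul q a _ ha =>
      rw [← TensorProduct.smul_tmul, ← TensorProduct.smul_tmul', ← algebraMap_smul A q]
      exact Submodule.smul_mem _ _ ha
end

open CategoryTheory

namespace FPkg
variable {A : Type} [CommRing A] {M : Type} [AddCommGroup M] [Module A M] {N : ℤ} {s : ℕ}
  (P : FPkg A M N s)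

theorem restr_mem (n : ℕ) (x : P.X) (hx : x ∈ LinearMap.range (P.p ((n + 1 : ℕ) : ℤ))) :
    P.d x ∈ LinearMap.range (P.p (n : ℤ)) := by
  obtain ⟨y, rfl⟩ := hx
  rw [P.dp, show (((n + 1 : ℕ) : ℤ) - 1) = n by push_cast; ring]
  exact ⟨_, rfl⟩

/-- the objects -/
noncomputable abbrev obj (n : ℕ) : ModuleCat.{0} A := ModuleCat.of A (LinearMap.range (P.p (n : ℤ)))

/-- the differential -/
noncomputable def dif (n : ℕ) : P.obj (n + 1) ⟶ P.obj n :=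
  ModuleCat.ofHom (P.d.restrict (P.restr_mem n))

theorem dif_dif (n : ℕ) : P.dif (n + 1) ≫ P.dif n = 0 := by
  ext x
  exact P.dd _

theorem dif_exact (n : ℕ) : (ShortComplex.mk (P.dif (n + 1)) (P.dif n) (P.dif_dif n)).Exact := by
  rw [ShortComplex.moduleCat_exact_iff]
  rintro ⟨x, hx⟩ h
  have hdx : P.d x = 0 := congrArg Subtype.val h
  have hpx : P.p ((n + 1 : ℕ) : ℤ) x = x := by
    obtain ⟨y, rfl⟩ := hx
    exact P.pp _ _
  have hε : P.ε x = 0 := by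
    rw [← P.εp, ← hpx, P.orth _ _ _ (by lia), map_zero]
  obtain ⟨y, hy⟩ := P.exact x hdx hε
  refine ⟨⟨P.p ((n + 1 + 1 : ℕ) : ℤ) y, y, rfl⟩, Subtype.ext ?_⟩
  change P.d (P.p ((n + 1 + 1 : ℕ) : ℤ) y) = x
  rw [P.dp, hy, show ((n + 1 + 1 : ℕ) : ℤ) - 1 = ((n + 1 : ℕ) : ℤ) by push_cast; ring, hpx]

/-- the augmentation -/
noncomputable def aug : P.obj 0 ⟶ ModuleCat.of A M :=
  ModuleCat.ofHom (P.ε ∘ₗ (LinearMap.range (P.p ((0 : ℕ) : ℤ))).subtype)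

theorem dif_aug : P.dif 0 ≫ P.aug = 0 := by
  ext x
  exact P.εd _

theorem aug_exact : (ShortComplex.mk (P.dif 0) P.aug P.dif_aug).Exact := by
  rw [ShortComplex.moduleCat_exact_iff]
  rintro ⟨x, hx⟩ h
  have hε : P.ε x = 0 := h
  have hpx : P.p 0 x = x := by
    obtain ⟨y, rfl⟩ := hx
    exact P.pp _ _
  have hdx : P.d x = 0 := by
    rw [← hpx, P.dp, P.neg _ (by lia)]
  obtain ⟨y, hy⟩ := P.exact x hdx hε
  refine ⟨⟨P.p ((0 + 1 : ℕ) : ℤ) y, y, rfl⟩, Subtype.ext ?_⟩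
  change P.d (P.p ((0 + 1 : ℕ) : ℤ) y) = x
  rw [P.dp, hy, show ((0 + 1 : ℕ) : ℤ) - 1 = 0 by simp, hpx]

theorem aug_epi : Epi P.aug := by
  rw [ModuleCat.epi_iff_surjective]
  intro m
  obtain ⟨x, rfl⟩ := P.surj m
  exact ⟨⟨P.p 0 x, x, rfl⟩, P.εp x⟩

/-- the complex -/
noncomputable def cpx : ChainComplex (ModuleCat.{0} A) ℕ := ChainComplex.of P.obj P.dif P.dif_dif

theorem cpx_d (n : ℕ) : P.cpx.d (n + 1) n = P.dif n := ChainComplex.of_d _ _ _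

theorem exists_res : ∃ R : ProjectiveResolution (ModuleCat.of A M), R.complex = P.cpx := by
  have := P.aug_epi
  refine ⟨{ complex := P.cpx
            π := (ChainComplex.toSingle₀Equiv _ _).symm ⟨P.aug, by rw [cpx_d]; exact P.dif_aug⟩
            projective := ?_
            quasiIso := ⟨fun n => ?_⟩ }, rfl⟩
  · intro n
    have := proj_range (P.p n) (P.pp n)
    exact ModuleCat.projective_of_categoryTheory_projective (P.obj n)
  · cases n
    · rw [ChainComplex.quasiIsoAt₀_iff, ShortComplex.quasiIso_iff_of_zeros']
      · refine (ShortComplex.exact_and_epi_g_iff_of_iso ?_).2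
          ⟨P.aug_exact, by dsimp; infer_instance⟩
        exact ShortComplex.isoMk (Iso.refl _) (Iso.refl _) (Iso.refl _)
          (by change 𝟙 _ ≫ P.dif 0 = P.cpx.d 1 0 ≫ 𝟙 _; rw [cpx_d]; exact (Category.id_comp _).trans (Category.comp_id _).symm) (by
            refine (Category.id_comp _).trans (Eq.trans ?_ (Category.comp_id _).symm)
            exact (ChainComplex.toSingle₀Equiv_symm_apply_f_zero (C := P.cpx) (X := ModuleCat.of A M) P.aug _).symm)
      all_goals rfl
    · rename_i n
      rw [quasiIsoAt_iff_exactAt']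
      · rw [HomologicalComplex.exactAt_iff' _ (n + 1 + 1) (n + 1) n (by simp) (by simp)]
        refine (ShortComplex.exact_iff_of_iso ?_).2 (P.dif_exact n)
        exact ShortComplex.isoMk (Iso.refl _) (Iso.refl _) (Iso.refl _)
          (by
            change 𝟙 _ ≫ P.dif (n + 1) = P.cpx.d (n + 1 + 1) (n + 1) ≫ 𝟙 _
            rw [cpx_d]; exact (Category.id_comp _).trans (Category.comp_id _).symm)
          (by
            change 𝟙 _ ≫ P.dif n = P.cpx.d (n + 1) n ≫ 𝟙 _
            rw [cpx_d]; exact (Category.id_comp _).trans (Category.comp_id _).symm)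
      · apply ChainComplex.exactAt_succ_single_obj
end FPkg

open CategoryTheory

namespace FPkg
variable {A : Type} [CommRing A] {M : Type} [AddCommGroup M] [Module A M] {N : ℤ} {s : ℕ}
  (P : FPkg A M N s)

/-- cocycles of degree `i` with values in `L` -/
def Z (L : Type) [AddCommGroup L] [Module A L] (i : ℤ) : Submodule A (P.X →ₗ[A] L) where
  carrier := {φ | φ ∘ₗ P.p i = φ ∧ φ ∘ₗ P.d = 0}
  add_mem' := fun {a b} ha hb => ⟨by rw [LinearMap.add_comp, ha.1, hb.1], by
    rw [LinearMap.add_comp, ha.2, hb.2, add_zero]⟩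
  zero_mem' := ⟨by simp, by simp⟩
  smul_mem' := fun q a ha => ⟨by rw [LinearMap.smul_comp, ha.1], by
    rw [LinearMap.smul_comp, ha.2, smul_zero]⟩

theorem exists_ext (L : Type) [AddCommGroup L] [Module A L] (i : ℕ) :
    ∃ q : P.Z L ((i + 1 : ℕ) : ℤ) →ₗ[A] extAP A M L (i + 1), Function.Surjective q ∧
      ∀ φ, q φ = 0 ↔ ∃ ψ : P.X →ₗ[A] L, φ.1 = ψ ∘ₗ P.d := by
  obtain ⟨R, hR⟩ := P.exists_res
  have e1 := R.isoExt (R := A) (i + 1) (ModuleCat.of A L)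
  rw [hR] at e1
  let C := P.cpx.linearYonedaObj A (ModuleCat.of A L)
  have e2 : C.homology (i + 1) ≅ (C.sc' i (i + 1) (i + 2)).homology :=
    ShortComplex.homologyMapIso (C.isoSc' i (i + 1) (i + 2) (by simp) (by simp))
  let S := C.sc' i (i + 1) (i + 2)
  have e3 := e1 ≪≫ e2 ≪≫ S.moduleCatHomologyIso
  have hg : ∀ φ : S.X₂, S.g φ = (P.dif (i + 1) ≫ (φ : P.obj (i + 1) ⟶ ModuleCat.of A L) : _) := by
    intro φ
    change P.cpx.d (i + 2) (i + 1) ≫ (φ : P.obj (i + 1) ⟶ ModuleCat.of A L) = _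
    rw [cpx_d]; rfl
  have hf : ∀ φ : S.X₁, S.f φ = (P.dif i ≫ (φ : P.obj i ⟶ ModuleCat.of A L) : _) := by
    intro φ
    change P.cpx.d (i + 1) i ≫ (φ : P.obj i ⟶ ModuleCat.of A L) = _
    rw [cpx_d]; rfl
  let V := LinearMap.range (P.p ((i + 1 : ℕ) : ℤ))
  let q0 : P.Z L ((i + 1 : ℕ) : ℤ) →ₗ[A] S.X₂ :=
    { toFun := fun φ => (ModuleCat.ofHom (φ.1 ∘ₗ V.subtype) : P.obj (i + 1) ⟶ ModuleCat.of A L)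
      map_add' := fun a b => rfl
      map_smul' := fun a b => rfl }
  let q1 : P.Z L ((i + 1 : ℕ) : ℤ) →ₗ[A] LinearMap.ker S.g.hom := q0.codRestrict _ (by
    intro φ
    rw [LinearMap.mem_ker]
    refine (hg _).trans ?_
    refine ModuleCat.hom_ext (LinearMap.ext fun x => ?_)
    exact LinearMap.congr_fun φ.2.2 _)
  have hq1 : Function.Surjective q1 := by
    rintro ⟨h, hh⟩
    let h' : P.obj (i + 1) ⟶ ModuleCat.of A L := h
    have hh' : P.dif (i + 1) ≫ h' = 0 := (hg h).symm.trans hh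
    have hh'' : ∀ x : P.obj (i + 2), h'.hom ((P.dif (i + 1)).hom x) = 0 := fun x =>
      LinearMap.congr_fun (congrArg ModuleCat.Hom.hom hh') x
    refine ⟨⟨h'.hom ∘ₗ (P.p ((i + 1 : ℕ) : ℤ)).rangeRestrict, ?_, ?_⟩, ?_⟩
    · ext x
      refine congrArg h'.hom (Subtype.ext ?_)
      exact P.pp _ _
    · ext x
      refine Eq.trans (congrArg h'.hom (Subtype.ext ?_)) (hh'' ⟨P.p ((i + 2 : ℕ) : ℤ) x, x, rfl⟩)
      change P.p ((i + 1 : ℕ) : ℤ) (P.d x) = P.d (P.p ((i + 2 : ℕ) : ℤ) x)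
      rw [P.dp, show ((i + 2 : ℕ) : ℤ) - 1 = ((i + 1 : ℕ) : ℤ) by push_cast; ring]
    · refine Subtype.ext (show (_ : P.obj (i + 1) ⟶ ModuleCat.of A L) = h' from ?_)
      ext ⟨_, y, rfl⟩
      refine congrArg h'.hom (Subtype.ext ?_)
      exact P.pp _ _
  refine ⟨e3.toLinearEquiv.symm.toLinearMap ∘ₗ 
    ((LinearMap.range S.moduleCatToCycles).mkQ : _ →ₗ[A] S.moduleCatLeftHomologyData.H) ∘ₗ q1, ?_, ?_⟩
  · exact e3.toLinearEquiv.symm.surjective.comp ((Submodule.mkQ_surjective _).comp hq1)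
  · intro φ
    have h1 : (e3.toLinearEquiv.symm.toLinearMap ∘ₗ 
      ((LinearMap.range S.moduleCatToCycles).mkQ : _ →ₗ[A] S.moduleCatLeftHomologyData.H) ∘ₗ q1) φ = 0 ↔ 
      q1 φ ∈ LinearMap.range S.moduleCatToCycles := by
      rw [LinearMap.comp_apply]
      refine (LinearEquiv.map_eq_zero_iff e3.toLinearEquiv.symm).trans ?_
      exact Submodule.Quotient.mk_eq_zero _
    rw [h1]
    constructor
    · rintro ⟨w, hw⟩
      let w' : P.obj i ⟶ ModuleCat.of A L := w
      have h2 : P.dif i ≫ w' = (ModuleCat.ofHom (φ.1 ∘ₗ V.subtype) : P.obj (i + 1) ⟶ ModuleCat.of A L) :=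
        (hf w).symm.trans (congrArg Subtype.val hw)
      have h3 : ∀ x : P.obj (i + 1), w'.hom ((P.dif i).hom x) = φ.1 x.1 := fun x => 
        LinearMap.congr_fun (congrArg ModuleCat.Hom.hom h2) x
      refine ⟨w'.hom ∘ₗ (P.p (i : ℤ)).rangeRestrict, ?_⟩
      ext x
      rw [← φ.2.1]
      refine (h3 ⟨P.p ((i + 1 : ℕ) : ℤ) x, x, rfl⟩).symm.trans ?_
      refine congrArg w'.hom (Subtype.ext ?_)
      change P.d (P.p ((i + 1 : ℕ) : ℤ) x) = P.p (i : ℤ) (P.d x)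
      rw [P.dp, show ((i + 1 : ℕ) : ℤ) - 1 = (i : ℤ) by push_cast; ring]
    · rintro ⟨ψ, hψ⟩
      refine ⟨(ModuleCat.ofHom (ψ ∘ₗ (LinearMap.range (P.p (i : ℤ))).subtype) : 
        P.obj i ⟶ ModuleCat.of A L), Subtype.ext ?_⟩
      refine (hf _).trans ?_
      change _ = (ModuleCat.ofHom (φ.1 ∘ₗ V.subtype) : P.obj (i + 1) ⟶ ModuleCat.of A L)
      ext x
      exact (LinearMap.congr_fun hψ x.1).symm
end FPkg

open CategoryTheory

theorem ar_lemma {R H : Type} [CommRing R] [IsNoetherianRing R] [AddCommGroup H] [Module R H]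
    (W : Submodule R H) (hW : W.FG) (B : Submodule R H) {κ : Type} (b : κ → R) :
    ∃ m : ℕ, ∀ w ∈ Ideal.span (Set.range b) ^ m • W, (∀ k, b k • w ∈ B) → w ∈ B := by
  have : Module.Finite R W := Module.Finite.iff_fg.2 hW
  let 𝔞 := Ideal.span (Set.range b)
  let N : Submodule R W :=
    { carrier := {w | ∀ k, b k • (w : H) ∈ B}
      add_mem' := fun {x y} hx hy k => by
        rw [Submodule.coe_add, smul_add]; exact B.add_mem (hx k) (hy k)
      zero_mem' := fun k => by simp
      smul_mem' := fun r x hx k => by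
        rw [Submodule.coe_smul, smul_comm]; exact B.smul_mem _ (hx k) }
  have hN : 𝔞 • N ≤ B.comap W.subtype := by
    rw [Submodule.smul_le]
    intro r hr n hn
    change r • (n : H) ∈ B
    induction hr using Submodule.span_induction with
    | mem x hx => obtain ⟨k, rfl⟩ := hx; exact hn k
    | zero => simp
    | add x y _ _ hx hy => rw [add_smul]; exact B.add_mem hx hy
    | smul a x _ hx => rw [smul_assoc]; exact B.smul_mem _ hx
  obtain ⟨k, hk⟩ := Ideal.exists_pow_inf_eq_pow_smul 𝔞 N
  refine ⟨k + 1, fun w hw hB => ?_⟩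
  have hw1 : w ∈ W := Submodule.smul_le_right hw
  have hw2 : (⟨w, hw1⟩ : W) ∈ 𝔞 ^ (k + 1) • (⊤ : Submodule R W) := by
    have : 𝔞 ^ (k + 1) • W = (𝔞 ^ (k + 1) • (⊤ : Submodule R W)).map W.subtype := by
      rw [Submodule.map_smul'']; simp
    rw [this] at hw
    obtain ⟨⟨v, hv⟩, hv1, hv2⟩ := hw
    have : v = w := hv2
    subst this
    exact hv1
  have h3 : (⟨w, hw1⟩ : W) ∈ 𝔞 ^ (k + 1) • (⊤ : Submodule R W) ⊓ N := ⟨hw2, hB⟩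
  rw [hk (k + 1) (by lia), show k + 1 - k = 1 by lia, pow_one] at h3
  exact hN (Submodule.smul_mono le_rfl inf_le_right h3)

theorem exists_action {A H ι : Type} [CommRing A] [AddCommGroup H] [Module A H]
    (ops : ι → Module.End A H) (hc : ∀ i j, ops i * ops j = ops j * ops i) :
    ∃ Φ : MvPolynomial ι A →+* Module.End A H, (∀ i, Φ (MvPolynomial.X i) = ops i) ∧
      ∀ a h, Φ (MvPolynomial.C a) h = a • h := by
  let S := Algebra.adjoin A (Set.range ops)
  letI : CommRing S := Algebra.adjoinCommRingOfComm A (by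
    rintro _ ⟨i, rfl⟩ _ ⟨j, rfl⟩; exact hc i j)
  let g : MvPolynomial ι A →+* S := MvPolynomial.eval₂Hom (algebraMap A S)
    (fun i => ⟨ops i, Algebra.subset_adjoin ⟨i, rfl⟩⟩)
  refine ⟨S.val.toRingHom.comp g, fun i => ?_, fun a h => ?_⟩
  · simp [g]
  · simp [g]

theorem ar_ops {A H ι κ : Type} [CommRing A] [IsNoetherianRing A] [Finite ι] [AddCommGroup H] [Module A H]
    (ops : ι → Module.End A H) (hc : ∀ i j, ops i * ops j = ops j * ops i)
    (δ : Module.End A H) (hδ : ∀ i h, δ (ops i h) = ops i (δ h)) (G : Set H) (hG : G.Finite)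
    (b : κ → ι × ι) :
    ∃ W : ℕ → Submodule A H, (∀ i, ∀ w ∈ W 0, ops i w ∈ W 0) ∧ G ⊆ W 0 ∧
      (∀ V : Submodule A H, G ⊆ V → (∀ i, ∀ v ∈ V, ops i v ∈ V) → W 0 ≤ V) ∧
      (∀ m k, ∀ w ∈ W m, ops (b k).1 (ops (b k).2 w) ∈ W (m + 1)) ∧
      ∃ m, ∀ w ∈ W m, (∀ k, ∃ v ∈ W 0, ops (b k).1 (ops (b k).2 w) = δ v) → ∃ v ∈ W 0, w = δ v := by
  obtain ⟨Φ, hX, hC⟩ := exists_action ops hc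
  let R := MvPolynomial ι A
  letI : Module R H := Module.compHom H Φ
  have hsm : ∀ (r : R) (h : H), r • h = Φ r h := fun r h => rfl
  have hXs : ∀ i (h : H), (MvPolynomial.X i : R) • h = ops i h := fun i h => by rw [hsm, hX]
  haveI : IsScalarTower A R H := IsScalarTower.of_algebraMap_smul (fun a h => hC a h)
  let δR : H →ₗ[R] H :=
    { toFun := δ
      map_add' := δ.map_add
      map_smul' := fun r h => by
        simp only [RingHom.id_apply, hsm]
        induction r using MvPolynomial.induction_on generalizing h with
        | C a => rw [hC, hC, map_smul]
        | add p q hp hq => rw [map_add, LinearMap.add_apply, LinearMap.add_apply, map_add, hp, hq]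
        | mul_X p i hp => rw [map_mul, hX, Module.End.mul_apply, Module.End.mul_apply, hp, hδ] }
  let W0 : Submodule R H := Submodule.span R G
  let β : κ → R := fun k => MvPolynomial.X (b k).1 * MvPolynomial.X (b k).2
  have hβ : ∀ k (h : H), β k • h = ops (b k).1 (ops (b k).2 h) := fun k h => by
    rw [← hXs, ← hXs, smul_smul]
  let 𝔞 := Ideal.span (Set.range β)
  obtain ⟨m, hm⟩ := ar_lemma W0 ⟨hG.toFinset, by simp [W0]⟩ (W0.map δR) β
  have hW0 : ∀ x, x ∈ (𝔞 ^ 0 • W0).restrictScalars A ↔ x ∈ W0 := fun x => by simp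
  refine ⟨fun m => (𝔞 ^ m • W0).restrictScalars A, ?_, ?_, ?_, ?_, m, ?_⟩
  · intro i w hw
    rw [hW0] at hw ⊢
    rw [← hXs]; exact W0.smul_mem _ hw
  · intro g hg
    exact (hW0 g).2 (Submodule.subset_span hg)
  · intro V hV hV' w hw
    rw [hW0] at hw
    let VR : Submodule R H :=
      { V with
        smul_mem' := fun r h hh => by
          change r • h ∈ V
          have hh' : h ∈ V := hh
          rw [hsm]
          clear hh
          induction r using MvPolynomial.induction_on generalizing h with
          | C a => rw [hC]; exact V.smul_mem _ hh'
          | add p q hp hq => rw [map_add, LinearMap.add_apply]; exact V.add_mem (hp _ hh') (hq _ hh')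
          | mul_X p i hp => rw [map_mul, hX, Module.End.mul_apply]; exact hp _ (hV' i _ hh') }
    have : W0 ≤ VR := Submodule.span_le.2 hV
    exact this hw
  · intro m k w hw
    have e : 𝔞 ^ (m + 1) • W0 = 𝔞 • (𝔞 ^ m • W0) := by rw [pow_succ']; exact Submodule.mul_smul _ _ _
    rw [← hβ, Submodule.restrictScalars_mem, e]
    exact Submodule.smul_mem_smul (Ideal.subset_span ⟨k, rfl⟩) hw
  · intro w hw h
    obtain ⟨v, hv, hv'⟩ := hm w hw (fun k => by
      obtain ⟨v, hv, hv'⟩ := h k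
      rw [hβ, hv']
      exact ⟨v, (hW0 v).1 hv, rfl⟩)
    exact ⟨v, (hW0 v).2 hv, hv'.symm⟩

open CategoryTheory

namespace FPkg
variable {A : Type} [CommRing A] {M : Type} [AddCommGroup M] [Module A M] {N : ℤ} {s : ℕ}
  (P : FPkg A M N s)

/-- cochains of degree `i` -/
def Co (D : Type) [AddCommGroup D] [Module A D] (i : ℤ) : Submodule A (P.X →ₗ[A] D) where
  carrier := {φ | φ ∘ₗ P.p i = φ}
  add_mem' := fun {a b} ha hb => by
    change (a + b) ∘ₗ _ = _
    rw [LinearMap.add_comp, ha, hb]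
  zero_mem' := by change (0 : P.X →ₗ[A] D) ∘ₗ _ = _; simp
  smul_mem' := fun q a ha => by
    change (q • a) ∘ₗ _ = _
    rw [LinearMap.smul_comp, ha]

theorem mem_Co {D : Type} [AddCommGroup D] [Module A D] {i : ℤ} {φ : P.X →ₗ[A] D} :
    φ ∈ P.Co D i ↔ ∀ x, φ (P.p i x) = φ x := 
  ⟨fun h x => LinearMap.congr_fun h x, fun h => LinearMap.ext h⟩

theorem Co_fg [IsNoetherianRing A] (D : Type) [AddCommGroup D] [Module A D] [Module.Finite A D] (i : ℤ) :
    (P.Co D i).FG := by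
  have : Module.Finite A (LinearMap.range (P.p i)) := Module.Finite.iff_fg.2 (P.fg i)
  let r : (LinearMap.range (P.p i) →ₗ[A] D) →ₗ[A] (P.X →ₗ[A] D) := LinearMap.lcomp A D (P.p i).rangeRestrict
  refine Submodule.FG.of_le (T := LinearMap.range r) ?_ ?_
  · rw [LinearMap.range_eq_map]
    exact (IsNoetherian.noetherian _).map _
  · intro φ hφ
    exact ⟨φ ∘ₗ (LinearMap.range (P.p i)).subtype, hφ⟩

theorem Co_cogen {D : Type} [AddCommGroup D] [Module A D] {i : ℤ} (hi : N < i) {φ : P.X →ₗ[A] D}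
    (hφ : φ ∈ P.Co D i) : φ = ∑ j, (φ ∘ₗ P.σ j) ∘ₗ P.t j := by
  rw [mem_Co] at hφ
  ext x
  rw [← hφ, ← P.cogen i hi x]
  simp only [map_sum, LinearMap.sum_apply, LinearMap.comp_apply]
  refine Finset.sum_congr rfl fun j _ => ?_
  rw [P.tp, P.σp, show i - 2 + 2 = i by ring, hφ]

theorem Co_σ {D : Type} [AddCommGroup D] [Module A D] {i : ℤ} {φ : P.X →ₗ[A] D}
    (hφ : φ ∈ P.Co D i) (j : Fin s) : φ ∘ₗ P.σ j ∈ P.Co D (i - 2) := by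
  rw [mem_Co] at hφ ⊢
  intro x
  simp only [LinearMap.comp_apply]
  rw [P.σp, show i - 2 + 2 = i by ring, hφ]

theorem Co_lift {D : Type} [AddCommGroup D] [Module A D] {i : ℤ} {φ : P.X →ₗ[A] D}
    (hφ : φ ∈ P.Co D i) {r : ℕ} (a : Fin r → A) (n : ℕ)
    (h : ∀ x, φ x ∈ Ideal.span (Set.range a) ^ (n + 1) • (⊤ : Submodule A D)) :
    ∃ ψ : Fin r → (P.X →ₗ[A] D), (∀ k, ψ k ∈ P.Co D i) ∧ (∀ k x, ψ k x ∈ 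
      Ideal.span (Set.range a) ^ n • (⊤ : Submodule A D)) ∧ φ = ∑ k, a k • ψ k := by
  let I := Ideal.span (Set.range a)
  let L := I ^ n • (⊤ : Submodule A D)
  let L' := I ^ (n + 1) • (⊤ : Submodule A D)
  let g : (Fin r → L) →ₗ[A] D := ∑ k, a k • (L.subtype ∘ₗ LinearMap.proj k)
  have hg : ∀ v, g v = ∑ k, a k • (v k : D) := fun v => by simp [g]
  have hL' : L' = I • L := by
    change I ^ (n + 1) • (⊤ : Submodule A D) = I • I ^ n • (⊤ : Submodule A D)
    rw [pow_succ']; exact Submodule.mul_smul _ _ _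
  have hgm : LinearMap.range g = L' := by
    rw [hL']
    apply le_antisymm
    · rintro _ ⟨v, rfl⟩
      rw [hg]
      exact Submodule.sum_mem _ fun k _ => Submodule.smul_mem_smul (Ideal.subset_span ⟨k, rfl⟩) (v k).2
    · rw [Submodule.smul_le]
      intro b hb x hx
      induction hb using Submodule.span_induction with
      | mem b hb =>
        obtain ⟨k, rfl⟩ := hb
        classical
        refine ⟨Pi.single k ⟨x, hx⟩, ?_⟩
        rw [hg, Finset.sum_eq_single k]
        · simp
        · intro k' _ hk'; simp [hk']
        · simp
      | zero => simp
      | add b c _ _ hb hc => rw [add_smul]; exact Submodule.add_mem _ hb hc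
      | smul c b _ hb => rw [smul_assoc]; exact Submodule.smul_mem _ _ hb
  let φ' : P.X →ₗ[A] LinearMap.range g := φ.codRestrict _ (fun x => by rw [hgm]; exact h x)
  obtain ⟨l, hl⟩ := Module.projective_lifting_property g.rangeRestrict φ' (LinearMap.surjective_rangeRestrict g)
  rw [mem_Co] at hφ
  refine ⟨fun k => L.subtype ∘ₗ LinearMap.proj k ∘ₗ l ∘ₗ P.p i, ?_, ?_, ?_⟩
  · intro k
    rw [mem_Co]
    intro x
    simp [P.pp]
  · intro k x
    exact (l (P.p i x) k).2
  · ext x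
    rw [← hφ x]
    have := congrArg Subtype.val (LinearMap.congr_fun hl (P.p i x))
    refine this.symm.trans ?_
    refine (hg (l (P.p i x))).trans ?_
    simp
end FPkg

open CategoryTheory

/-- shift-multiplication by `a` on sequences -/
def shiftMul {A : Type} [CommRing A] (E : Type) [AddCommGroup E] [Module A E] (a : A) :
    Module.End A (ℕ → E) where
  toFun w := fun n => Nat.casesOn n 0 (fun m => a • w m)
  map_add' u v := by
    funext n
    cases n with
    | zero => simp
    | succ m => simp
  map_smul' r v := by
    funext n
    cases n with
    | zero => simp
    | succ m => simp [smul_comm a r]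

/-- pointwise operator on sequences -/
def ptw {A : Type} [CommRing A] {E : Type} [AddCommGroup E] [Module A E] (g : Module.End A E) :
    Module.End A (ℕ → E) where
  toFun w := fun n => g (w n)
  map_add' u v := by
    funext n; simp
  map_smul' r v := by
    funext n; simp

section
variable {A : Type} [CommRing A] {E : Type} [AddCommGroup E] [Module A E]

theorem ptw_apply (g : Module.End A E) (w : ℕ → E) (n : ℕ) : ptw g w n = g (w n) := rfl
theorem shiftMul_zero (a : A) (w : ℕ → E) : shiftMul E a w 0 = 0 := rfl
theorem shiftMul_succ (a : A) (w : ℕ → E) (n : ℕ) : shiftMul E a w (n + 1) = a • w n := rfl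

theorem ptw_shift (g : Module.End A E) (a : A) (w : ℕ → E) :
    ptw g (shiftMul E a w) = shiftMul E a (ptw g w) := by
  funext n
  cases n with
  | zero => simp [ptw_apply, shiftMul_zero]
  | succ m => simp [ptw_apply, shiftMul_succ]

theorem shift_shift (a b : A) (w : ℕ → E) :
    shiftMul E a (shiftMul E b w) = shiftMul E b (shiftMul E a w) := by
  funext n
  rcases n with _ | _ | n
  · simp [shiftMul_zero]
  · simp [shiftMul_zero, shiftMul_succ]
  · simp [shiftMul_succ, smul_comm a b]

theorem ptw_single (g : Module.End A E) (n : ℕ) (e : E) :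
    ptw g (Pi.single n e) = Pi.single n (g e) := by
  funext m
  rw [ptw_apply]
  by_cases h : m = n
  · subst h; simp
  · simp [Pi.single_eq_of_ne h]

theorem shift_single (a : A) (n : ℕ) (e : E) :
    shiftMul E a (Pi.single n e) = Pi.single (n + 1) (a • e) := by
  funext m
  cases m with
  | zero => simp [shiftMul_zero]
  | succ m =>
    rw [shiftMul_succ]
    by_cases h : m = n
    · subst h; simp
    · rw [Pi.single_eq_of_ne h, Pi.single_eq_of_ne (by lia), smul_zero]
end

namespace FPkg
variable {A : Type} [CommRing A] {M : Type} [AddCommGroup M] [Module A M] {N : ℤ} {s : ℕ}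
  (P : FPkg A M N s)

theorem main_ar [IsNoetherianRing A] (D : Type) [AddCommGroup D] [Module A D] [Module.Finite A D]
    {r : ℕ} (a : Fin r → A) :
    ∃ i₀ n₀ : ℕ, ∀ i : ℤ, i₀ ≤ i → ∀ n ≥ n₀, ∀ φ ∈ P.Co D i,
      (∀ x, φ x ∈ Ideal.span (Set.range a) ^ n • (⊤ : Submodule A D)) →
      (∀ j k, ∃ ψ : P.X →ₗ[A] D, (∀ x, ψ x ∈ Ideal.span (Set.range a) ^ (n + 1) • (⊤ : Submodule A D)) ∧
        a k • (φ ∘ₗ P.t j) = ψ ∘ₗ P.d) →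
      ∃ ψ : P.X →ₗ[A] D, (∀ x, ψ x ∈ Ideal.span (Set.range a) ^ n • (⊤ : Submodule A D)) ∧
        φ = ψ ∘ₗ P.d := by
  classical
  set I := Ideal.span (Set.range a) with hI
  let E := P.X →ₗ[A] D
  let ops : Fin s ⊕ Fin r → Module.End A (ℕ → E) :=
    Sum.elim (fun j => ptw (LinearMap.lcomp A D (P.t j))) (fun k => shiftMul E (a k))
  let δ : Module.End A (ℕ → E) := ptw (LinearMap.lcomp A D P.d)
  have opl : ∀ j n (φ : E), ops (Sum.inl j) (Pi.single n φ) = Pi.single n (φ ∘ₗ P.t j) :=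
    fun j n φ => ptw_single _ n φ
  have opr : ∀ k n (φ : E), ops (Sum.inr k) (Pi.single n φ) = Pi.single (n + 1) (a k • φ) :=
    fun k n φ => shift_single _ n φ
  have hδs : ∀ n (φ : E), δ (Pi.single n φ) = Pi.single n (φ ∘ₗ P.d) := fun n φ => ptw_single _ n φ
  have hc : ∀ i j, ops i * ops j = ops j * ops i := by
    rintro (i | i) (j | j) <;> refine LinearMap.ext fun w => ?_
    · funext n
      refine LinearMap.ext fun x => ?_
      exact congrArg (w n) (P.tt j i x)
    · exact ptw_shift (LinearMap.lcomp A D (P.t i)) (a j) w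
    · exact (ptw_shift (LinearMap.lcomp A D (P.t j)) (a i) w).symm
    · exact shift_shift _ _ _
  have hδ : ∀ i h, δ (ops i h) = ops i (δ h) := by
    rintro (i | i) w
    · funext n
      refine LinearMap.ext fun x => ?_
      exact congrArg (w n) (P.td i x)
    · exact ptw_shift (LinearMap.lcomp A D P.d) (a i) w
  choose S hS using fun i : ℤ => P.Co_fg D i
  let G : Set (ℕ → E) := ⋃ i ∈ Set.Icc 0 N, (fun φ : E => Pi.single 0 φ) '' (S i : Set E)
  have hG : G.Finite := by
    refine Set.Finite.biUnion (Set.finite_Icc 0 N) fun i _ => ?_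
    exact (S i).finite_toSet.image _
  obtain ⟨W, hW1, hW2, hW3, hW4, m, hW5⟩ := ar_ops ops hc δ hδ G hG
    (fun p : Fin s × Fin r => (Sum.inl p.1, Sum.inr p.2))
  -- values
  have hval : ∀ w ∈ W 0, ∀ n x, w n x ∈ I ^ n • (⊤ : Submodule A D) := by
    let V : Submodule A (ℕ → E) :=
      { carrier := {w | ∀ n x, w n x ∈ I ^ n • (⊤ : Submodule A D)}
        add_mem' := fun hu hv n x => Submodule.add_mem _ (hu n x) (hv n x)
        zero_mem' := fun n x => Submodule.zero_mem _
        smul_mem' := fun c u hu n x => Submodule.smul_mem _ c (hu n x) }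
    have : W 0 ≤ V := by
      refine hW3 V ?_ ?_
      · intro w hw n x
        simp only [G, Set.mem_iUnion] at hw
        obtain ⟨i, _, φ, _, rfl⟩ := hw
        cases n with
        | zero => simp
        | succ n =>
          have h0 : (Pi.single 0 φ : ℕ → E) (n + 1) = 0 := Pi.single_eq_of_ne (Nat.succ_ne_zero n) φ
          change (Pi.single 0 φ : ℕ → E) (n + 1) x ∈ _
          rw [h0]
          exact Submodule.zero_mem _
      · rintro (j | k) v hv n x
        · exact hv n (P.t j x)
        · cases n with
          | zero => exact Submodule.zero_mem _
          | succ n =>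
            change a k • v n x ∈ _
            rw [pow_succ', Submodule.mul_smul]
            exact Submodule.smul_mem_smul (Ideal.subset_span ⟨k, rfl⟩) (hv n x)
    exact fun w hw => this hw
  -- (a)
  have hA : ∀ (q : ℕ) (i : ℤ), i < q → ∀ φ ∈ P.Co D i, (Pi.single 0 φ : ℕ → E) ∈ W 0 := by
    intro q
    induction q with
    | zero =>
      intro i hi φ hφ
      have : φ = 0 := by
        ext x
        rw [← P.mem_Co.1 hφ, P.neg i (by simpa using hi)]; simp
      rw [this, Pi.single_zero]
      exact Submodule.zero_mem _
    | succ q ih =>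
      intro i hi φ hφ
      by_cases h0 : i < 0
      · exact ih i (by lia) φ hφ
      by_cases hN : N < i
      · rw [P.Co_cogen hN hφ, ← LinearMap.single_apply (R := A) (φ := fun _ : ℕ => E), map_sum]
        refine Submodule.sum_mem _ fun j _ => ?_
        rw [LinearMap.single_apply, ← opl]
        refine hW1 _ _ (ih (i - 2) (by push_cast at hi; lia) _ (P.Co_σ hφ j))
      · have : P.Co D i ≤ (W 0).comap (LinearMap.single A (fun _ : ℕ => E) 0) := by
          rw [← hS i, Submodule.span_le]
          intro ψ hψ
          refine hW2 ?_
          simp only [G, Set.mem_iUnion]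
          exact ⟨i, ⟨by lia, by lia⟩, ψ, hψ, rfl⟩
        exact this hφ
  have hB : ∀ (n : ℕ) (i : ℤ), ∀ φ ∈ P.Co D i, (∀ x, φ x ∈ I ^ n • (⊤ : Submodule A D)) →
      (Pi.single n φ : ℕ → E) ∈ W 0 := by
    intro n
    induction n with
    | zero =>
      intro i φ hφ _
      exact hA (i.toNat + 1) i (by lia) φ hφ
    | succ n ih =>
      intro i φ hφ h
      obtain ⟨ψ, h1, h2, rfl⟩ := P.Co_lift hφ a n h
      rw [← LinearMap.single_apply (R := A) (φ := fun _ : ℕ => E), map_sum]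
      refine Submodule.sum_mem _ fun k _ => ?_
      rw [LinearMap.single_apply, ← opr]
      exact hW1 _ _ (ih i _ (h1 k) (h2 k))
  have hC : ∀ (m n : ℕ) (i : ℤ), m ≤ n → N + 2 * m < i → ∀ φ ∈ P.Co D i,
      (∀ x, φ x ∈ I ^ n • (⊤ : Submodule A D)) → (Pi.single n φ : ℕ → E) ∈ W m := by
    intro m
    induction m with
    | zero =>
      intro n i _ _ φ hφ h
      exact hB n i φ hφ h
    | succ m ih =>
      intro n i hn hi φ hφ h
      obtain ⟨n, rfl⟩ : ∃ n', n = n' + 1 := ⟨n - 1, by lia⟩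
      obtain ⟨ψ, h1, h2, rfl⟩ := P.Co_lift hφ a n h
      rw [← LinearMap.single_apply (R := A) (φ := fun _ : ℕ => E), map_sum]
      refine Submodule.sum_mem _ fun k _ => ?_
      rw [P.Co_cogen (i := i) (by push_cast at hi; lia) (h1 k), Finset.smul_sum, map_sum]
      refine Submodule.sum_mem _ fun j _ => ?_
      have := hW4 m (j, k) _ (ih n (i - 2) (by lia) (by push_cast at hi; lia) _ (P.Co_σ (h1 k) j)
        (fun x => h2 k _))
      rw [opr, opl] at this
      exact this
  refine ⟨(N + 2 * m + 1).toNat, m, fun i hi n hn φ hφ hv hex => ?_⟩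
  obtain ⟨v, hv0, hv1⟩ := hW5 (Pi.single n φ) (hC m n i hn (by lia) φ hφ hv) (by
    rintro ⟨j, k⟩
    obtain ⟨ψ, hψ, he⟩ := hex j k
    refine ⟨Pi.single (n + 1) (ψ ∘ₗ P.p (i + 1)), hB _ (i + 1) _ ?_ fun x => hψ _, ?_⟩
    · rw [P.mem_Co]
      intro x
      simp [P.pp]
    · rw [opr, opl, hδs]
      congr 1
      ext x
      have h1 := LinearMap.congr_fun he (P.p (i + 2) x)
      simp only [LinearMap.smul_apply, LinearMap.comp_apply, P.tp, P.dp] at h1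
      have h2 := P.mem_Co.1 hφ (P.t j x)
      rw [show i + 2 - 2 = i by ring, show i + 2 - 1 = i + 1 by ring, h2] at h1
      exact h1)
  refine ⟨v n, fun x => hval v hv0 n x, ?_⟩
  have := congrFun hv1 n
  rw [Pi.single_eq_same] at this
  exact this
end FPkg

open CategoryTheory

theorem ass_pow {A : Type} [CommRing A] (E : Type) [AddCommGroup E] [Module A E] (l : ℕ) :
    associatedPrimes A (Fin l → E) ⊆ associatedPrimes A E := by
  induction l with
  | zero =>
    rw [associatedPrimes.eq_empty_of_subsingleton]
    exact Set.empty_subset _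
  | succ l ih =>
    rw [← LinearEquiv.AssociatedPrimes.eq (Fin.consLinearEquiv A (fun _ : Fin (l + 1) => E)),
      associatedPrimes.prod]
    exact Set.union_subset subset_rfl ih

theorem desc_inj {A : Type} [CommRing A] {Z E Z' E' K : Type} [AddCommGroup Z] [Module A Z]
    [AddCommGroup E] [Module A E] [AddCommGroup Z'] [Module A Z'] [AddCommGroup E'] [Module A E']
    [Finite K]
    (q : Z →ₗ[A] E) (hq : Function.Surjective q) (q' : Z' →ₗ[A] E') (g : K → Z →ₗ[A] Z')
    (h1 : ∀ k z, q z = 0 → q' (g k z) = 0) (h2 : ∀ z, (∀ k, q' (g k z) = 0) → q z = 0) :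
    ∃ φ : E →ₗ[A] (Fin (Nat.card K + 1) → E'), Function.Injective φ := by
  let G : Z →ₗ[A] (K → E') := LinearMap.pi fun k => q' ∘ₗ g k
  let Gb : (Z ⧸ LinearMap.ker q) →ₗ[A] (K → E') := (LinearMap.ker q).liftQ G (by
    intro z hz
    rw [LinearMap.mem_ker] at hz ⊢
    funext k
    exact h1 k z hz)
  have hGb : Function.Injective Gb := by
    rw [← LinearMap.ker_eq_bot, LinearMap.ker_eq_bot']
    intro z hz
    induction z using Submodule.Quotient.induction_on with
    | _ z =>
      rw [Submodule.Quotient.mk_eq_zero]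
      exact h2 z fun k => congrFun hz k
  let e := (q.quotKerEquivOfSurjective hq).symm
  let F : (K → E') →ₗ[A] (Fin (Nat.card K + 1) → E') :=
    (Fin.consLinearEquiv A (fun _ : Fin (Nat.card K + 1) => E')).toLinearMap ∘ₗ
      LinearMap.inr A E' (Fin (Nat.card K) → E') ∘ₗ
      (LinearEquiv.funCongrLeft A E' (Finite.equivFin K).symm).toLinearMap
  have hF : Function.Injective F := by
    refine (Fin.consLinearEquiv A (fun _ : Fin (Nat.card K + 1) => E')).injective.comp
      (LinearMap.inr_injective.comp
        (LinearEquiv.funCongrLeft A E' (Finite.equivFin K).symm).injective)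
  exact ⟨F ∘ₗ Gb ∘ₗ e.toLinearMap, hF.comp (hGb.comp e.injective)⟩

namespace FPkg
variable {A : Type} [CommRing A] {M : Type} [AddCommGroup M] [Module A M] {N : ℤ} {s : ℕ}

theorem final (P : FPkg A M N s) [IsNoetherianRing A] (D : Type) [AddCommGroup D] [Module A D] [Module.Finite A D]
    (I : Ideal A) :
    ∃ l : ℕ, 0 < l ∧ ∃ i₀ n₀ : ℕ, ∀ i ≥ i₀, ∀ n ≥ n₀,
      (∃ φ : extAP A M (↥(I ^ n • (⊤ : Submodule A D))) i →ₗ[A]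
          (Fin l → extAP A M (↥(I ^ (n + 1) • (⊤ : Submodule A D))) (i + 2)),
        Function.Injective φ) := by
  obtain ⟨r, a, rfl⟩ := Submodule.fg_iff_exists_fin_generating_family.1 (IsNoetherian.noetherian I)
  obtain ⟨i₀, n₀, h⟩ := P.main_ar D a
  refine ⟨Nat.card (Fin s × Fin r) + 1, Nat.succ_pos _, i₀ + 1, n₀, fun i hi n hn => ?_⟩
  obtain ⟨i, rfl⟩ : ∃ j, i = j + 1 := ⟨i - 1, by lia⟩
  change ∃ φ : extAP A M (↥((Ideal.span (Set.range a)) ^ n • (⊤ : Submodule A D))) (i + 1) →ₗ[A]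
          (Fin _ → extAP A M (↥((Ideal.span (Set.range a)) ^ (n + 1) • (⊤ : Submodule A D))) (i + 2 + 1)),
        Function.Injective φ
  set I := Ideal.span (Set.range a) with hI
  let L := I ^ n • (⊤ : Submodule A D)
  let L' := I ^ (n + 1) • (⊤ : Submodule A D)
  obtain ⟨q, hq, hq0⟩ := P.exists_ext L i
  obtain ⟨q', hq', hq0'⟩ := P.exists_ext L' (i + 2)
  let mu : Fin r → L →ₗ[A] L' := fun k => LinearMap.codRestrict L' (a k • L.subtype) (by
    intro x
    change a k • (x : D) ∈ I ^ (n + 1) • (⊤ : Submodule A D)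
    rw [pow_succ', Submodule.mul_smul]
    exact Submodule.smul_mem_smul (Ideal.subset_span ⟨k, rfl⟩) x.2)
  have hmu : ∀ k x, (mu k x : D) = a k • (x : D) := fun k x => rfl
  let g : Fin s × Fin r → P.Z L ((i + 1 : ℕ) : ℤ) →ₗ[A] P.Z L' ((i + 2 + 1 : ℕ) : ℤ) := fun jk =>
    { toFun := fun φ => ⟨mu jk.2 ∘ₗ φ.1 ∘ₗ P.t jk.1, by
        have h1 := fun x => LinearMap.congr_fun φ.2.1 x
        have h2 := fun x => LinearMap.congr_fun φ.2.2 x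
        simp only [LinearMap.comp_apply] at h1 h2
        constructor
        · ext x
          simp only [LinearMap.comp_apply]
          rw [P.tp, show ((i + 2 + 1 : ℕ) : ℤ) - 2 = ((i + 1 : ℕ) : ℤ) by push_cast; ring, h1]
        · ext x
          simp only [LinearMap.comp_apply]
          rw [P.td, h2]
          simp⟩
      map_add' := fun φ ψ => by
        ext x
        simp
      map_smul' := fun c φ => by
        ext x
        simp }
  refine desc_inj (Z := P.Z L ((i + 1 : ℕ) : ℤ)) (Z' := P.Z L' ((i + 2 + 1 : ℕ) : ℤ)) q hq q' g ?_ ?_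
  · rintro ⟨j, k⟩ z hz
    obtain ⟨ψ, hψ⟩ := (hq0 z).1 hz
    refine (hq0' _).2 ⟨mu k ∘ₗ ψ ∘ₗ P.t j, ?_⟩
    change mu k ∘ₗ z.1 ∘ₗ P.t j = _
    rw [hψ]
    ext x
    simp [P.td]
  · intro z hz
    obtain ⟨ψ, hψ, he⟩ := h ((i + 1 : ℕ) : ℤ) (by push_cast; lia) n hn (L.subtype ∘ₗ z.1)
      (P.mem_Co.2 fun x => congrArg Subtype.val (LinearMap.congr_fun z.2.1 x)) (fun x => (z.1 x).2)
      (by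
        intro j k
        obtain ⟨ψ, hψ⟩ := (hq0' _).1 (hz (j, k))
        refine ⟨L'.subtype ∘ₗ ψ, fun x => (ψ x).2, ?_⟩
        ext x
        exact congrArg Subtype.val (LinearMap.congr_fun hψ x))
    refine (hq0 z).2 ⟨LinearMap.codRestrict L ψ hψ, ?_⟩
    ext x
    exact LinearMap.congr_fun he x
end FPkg

theorem reg_aux {Q : Type} [CommRing Q] (c : ℕ) (f : Fin c → Q)
    (hreg : RingTheory.Sequence.IsRegular Q (List.ofFn f)) (k : Fin c) (q : Q)
    (h : f k * q ∈ (⊥ : Ideal Q) ⊔ Ideal.span (f '' {j | j < k})) :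
    q ∈ (⊥ : Ideal Q) ⊔ Ideal.span (f '' {j | j < k}) := by
  rw [bot_sup_eq] at h ⊢
  have h1 := hreg.toIsWeaklyRegular.regular_mod_prev k (by simp)
  have h2 : (Ideal.ofList ((List.ofFn f).take k) • ⊤ : Submodule Q Q) = Ideal.span (f '' {j | j < k}) := by
    rw [smul_eq_mul, Ideal.mul_top, Ideal.ofList]
    congr 1
    ext x
    simp only [Set.mem_ofPred_eq, Set.mem_image, List.mem_take_iff_getElem, List.getElem_ofFn]
    constructor
    · rintro ⟨i, hi, rfl⟩
      refine ⟨⟨i, by lia⟩, ?_, rfl⟩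
      rw [Fin.lt_def]; simp at hi ⊢; lia
    · rintro ⟨j, hj, rfl⟩
      exact ⟨j, by simp; exact hj, rfl⟩
  rw [h2] at h1
  have := @h1 (Submodule.Quotient.mk q) 0 (by
    simp only [smul_zero, List.getElem_ofFn]
    rw [← Submodule.Quotient.mk_smul, Submodule.Quotient.mk_eq_zero]
    exact h)
  rwa [Submodule.Quotient.mk_eq_zero] at this

/-- With `Q` Noetherian of finite Krull dimension, `f_1,…,f_c` a regular
sequence, `A = Q/(f)`, `M` a finitely generated `A`-module of finite projective dimension over
`Q`, `I` an ideal and `D` a finitely generated `A`-module: there exist `l ≥ 1` and `i₀, n₀`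
such that for all `i ≥ i₀`, `n ≥ n₀` there is an injective `A`-linear map
`Ext^i_A(M, IⁿD) ↪ (Ext^{i+2}_A(M, I^{n+1}D))^l`; in particular
`Ass_A Ext^i_A(M, IⁿD) ⊆ Ass_A Ext^{i+2}_A(M, I^{n+1}D)` in that range. -/
theorem stmt8 (Q : Type) [CommRing Q] [IsNoetherianRing Q]
    (hdim : ringKrullDim Q < ⊤)
    (c : ℕ) (f : Fin c → Q) (hreg : RingTheory.Sequence.IsRegular Q (List.ofFn f))
    (A : Type) [CommRing A] [Algebra Q A]
    (hsurj : Function.Surjective (algebraMap Q A))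
    (hker : RingHom.ker (algebraMap Q A) = Ideal.span (Set.range f))
    (M : Type) [AddCommGroup M] [Module A M] [Module Q M] [IsScalarTower Q A M]
    [Module.Finite A M]
    -- `M` has finite projective dimension over `Q`:
    (hproj : ∃ n : ℕ, ∀ (L : Type) [AddCommGroup L] [Module Q L], ∀ i : ℕ, n < i →
      Subsingleton (extAP Q M L i))
    (I : Ideal A) (D : Type) [AddCommGroup D] [Module A D] [Module.Finite A D] :
    ∃ l : ℕ, 0 < l ∧ ∃ i₀ n₀ : ℕ, ∀ i ≥ i₀, ∀ n ≥ n₀,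
      (∃ φ : extAP A M (↥(I ^ n • (⊤ : Submodule A D))) i →ₗ[A]
          (Fin l → extAP A M (↥(I ^ (n + 1) • (⊤ : Submodule A D))) (i + 2)),
        Function.Injective φ) ∧
      associatedPrimes A (extAP A M (↥(I ^ n • (⊤ : Submodule A D))) i) ⊆
        associatedPrimes A (extAP A M (↥(I ^ (n + 1) • (⊤ : Submodule A D))) (i + 2)) := by

  have : IsNoetherianRing A := isNoetherianRing_of_surjective Q A (algebraMap Q A) hsurj
  have : Module.Finite Q A := Module.Finite.of_surjective (Algebra.linearMap Q A) hsurj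
  have : Module.Finite Q M := Module.Finite.trans A M
  have hf : ∀ j (m : M), f j • m = 0 := by
    intro j m
    have : f j ∈ RingHom.ker (algebraMap Q A) := by
      rw [hker]; exact Ideal.subset_span ⟨j, rfl⟩
    rw [← algebraMap_smul A, (RingHom.mem_ker).1 this, zero_smul]
  obtain ⟨n, hn⟩ := hproj
  have hpd : HasProjectiveDimensionLT (ModuleCat.of Q M) (n + 1) := pd_of_ext M n hn
  have hpd' : HasProjectiveDimensionLT (ModuleCat.of Q M) (n + 1 + 1) :=
    hasProjectiveDimensionLT_of_ge _ (n + 1) _ (by lia)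
  obtain ⟨S⟩ := exists_stage f M hf (n + 1 + 1)
  obtain ⟨T⟩ := exists_tower_zero (n + 1) (by lia) S hpd'
  obtain ⟨g, ⟨T'⟩⟩ := exists_tower f ⊥ T (reg_aux c f hreg)
  rw [bot_sup_eq, ← hker] at T'
  obtain ⟨P⟩ := T'.toFPkg hsurj
  obtain ⟨l, hl, i₀, n₀, h⟩ := P.final D I
  refine ⟨l, hl, i₀, n₀, fun i hi n hn => ⟨h i hi n hn, ?_⟩⟩
  obtain ⟨φ, hφ⟩ := h i hi n hn
  exact (associatedPrimes.subset_of_injective hφ).trans (ass_pow _ l)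
end

section
/- Let (A,𝔪) be a commutative Noetherian local ring and let Â denote its 𝔪-adic completion. Let B be a finitely generated Â-algebra whose structure map Â → B is injective, and let E be an A-module such that E ⊗_A Â is a finitely generated B-module. Then Ass_A E = Ass_A (E ⊗_A Â); in particular Ass_A E is a finite set. -/
open TensorProduct

section Noeth

/-- An element of `(mC)^d` is congruent modulo `(mC)^(d+1)` to the image of an element of `m^d`. -/
lemma aux_lead {A C : Type*} [CommRing A] [CommRing C] [Algebra A C] (m : Ideal A)
    (hres : ∀ r : C, ∃ a : A, r - algebraMap A C a ∈ m.map (algebraMap A C))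
    (d : ℕ) (c : C) (hc : c ∈ (m.map (algebraMap A C)) ^ d) :
    ∃ a ∈ m ^ d, c - algebraMap A C a ∈ (m.map (algebraMap A C)) ^ (d + 1) := by
  rw [← Ideal.map_pow] at hc
  unfold Ideal.map at hc
  induction hc using Submodule.span_induction with
  | mem x h =>
    obtain ⟨a, ha, rfl⟩ := h
    exact ⟨a, ha, by simp⟩
  | zero => exact ⟨0, by simp, by simp⟩
  | add x y _ _ hx hy =>
    obtain ⟨a, ha, ha'⟩ := hx
    obtain ⟨b, hb, hb'⟩ := hy
    refine ⟨a + b, add_mem ha hb, ?_⟩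
    have := add_mem ha' hb'
    rw [map_add]
    convert this using 1
    ring
  | smul r x _ hx =>
    obtain ⟨a, ha, ha'⟩ := hx
    obtain ⟨s, hs⟩ := hres r
    refine ⟨s * a, Ideal.mul_mem_left _ _ ha, ?_⟩
    have h1 : algebraMap A C a ∈ (m.map (algebraMap A C)) ^ d := by
      rw [← Ideal.map_pow]; exact Ideal.mem_map_of_mem _ ha
    have h2 := Ideal.mul_mem_mul hs h1
    rw [← pow_succ'] at h2
    have := add_mem (Ideal.mul_mem_left _ r ha') h2
    convert this using 1
    rw [map_mul, smul_eq_mul]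
    ring

/-- Successive approximation. -/
lemma aux_complete {C ι : Type*} [CommRing C] [Fintype ι] (I J : Ideal C) [IsAdicComplete I C]
    (g : ι → C) (hg : ∀ i, g i ∈ J) (K : ℕ)
    (H : ∀ d, ∀ c ∈ J, c ∈ I ^ d → ∃ r : ι → C, (∀ i, r i ∈ I ^ (d - K)) ∧
      c - ∑ i, r i * g i ∈ I ^ (d + 1)) :
    ∀ c ∈ J, c ∈ Ideal.span (Set.range g) := by
  intro c hc
  have hJ : ∀ u : ι → C, ∑ i, u i * g i ∈ J := fun u =>
    sum_mem fun i _ => Ideal.mul_mem_left _ _ (hg i)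
  have step : ∀ (d : ℕ) (u : {u : ι → C // c - ∑ i, u i * g i ∈ I ^ d}),
      ∃ v : {u : ι → C // c - ∑ i, u i * g i ∈ I ^ (d + 1)},
        ∀ i, v.1 i - u.1 i ∈ I ^ (d - K) := by
    rintro d ⟨u, hu⟩
    obtain ⟨r, hr, hr'⟩ := H d _ (sub_mem hc (hJ u)) hu
    refine ⟨⟨fun i => u i + r i, ?_⟩, fun i => by simpa using hr i⟩
    convert hr' using 1
    simp only [add_mul, Finset.sum_add_distrib]
    ring
  choose F hF using step
  let U : ∀ d : ℕ, {u : ι → C // c - ∑ i, u i * g i ∈ I ^ d} := fun d =>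
    Nat.rec ⟨0, by simp⟩ (fun d u => F d u) d
  have hU : ∀ d i, (U (d + 1)).1 i - (U d).1 i ∈ I ^ (d - K) := fun d i => hF d (U d) i
  have hmono : ∀ i n k, (U (n + K + k)).1 i - (U (n + K)).1 i ∈ I ^ n := by
    intro i n k
    induction k with
    | zero => simp
    | succ k ih =>
      have h1 := hU (n + K + k) i
      have h2 : I ^ (n + K + k - K) ≤ I ^ n := Ideal.pow_le_pow_right (by omega)
      have := add_mem (h2 h1) ih
      rw [sub_add_sub_cancel] at this
      exact this
  have hlim : ∀ i, ∃ L : C, ∀ n, (U (n + K)).1 i - L ∈ I ^ n := by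
    intro i
    obtain ⟨L, hL⟩ := IsPrecomplete.prec (I := I) (M := C) inferInstance
      (f := fun n => (U (n + K)).1 i) (by
        intro a b hab
        obtain ⟨k, rfl⟩ := Nat.exists_eq_add_of_le hab
        rw [SModEq.sub_mem, ← neg_mem_iff, neg_sub, smul_eq_mul, Ideal.mul_top]
        have := hmono i a k
        rwa [show a + K + k = a + k + K by ring] at this)
    refine ⟨L, fun n => ?_⟩
    have := hL n
    rwa [SModEq.sub_mem, smul_eq_mul, Ideal.mul_top] at this
  choose L hL using hlim
  have hz : c - ∑ i, L i * g i = 0 := by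
    apply IsHausdorff.haus (I := I) (M := C) inferInstance
    intro n
    rw [SModEq.zero, smul_eq_mul, Ideal.mul_top]
    have h1 : c - ∑ i, (U (n + K)).1 i * g i ∈ I ^ n :=
      Ideal.pow_le_pow_right (by omega) (U (n + K)).2
    have h2 : ∑ i, ((U (n + K)).1 i - L i) * g i ∈ I ^ n :=
      sum_mem fun i _ => Ideal.mul_mem_right _ _ (hL i n)
    convert add_mem h1 h2 using 1
    simp only [sub_mul, Finset.sum_sub_distrib]
    ring
  rw [sub_eq_zero.mp hz]
  exact sum_mem fun i _ => Ideal.mul_mem_left _ _ (Ideal.subset_span ⟨i, rfl⟩)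

/-- The ideal of leading forms in the Rees algebra. -/
def leadIdeal {A C : Type*} [CommRing A] [CommRing C] [Algebra A C] (m : Ideal A)
    (J : Ideal C) : Ideal (reesAlgebra m) where
  carrier := {f | ∀ d, algebraMap A C (f.1.coeff d) ∈ J ⊔ (m.map (algebraMap A C)) ^ (d + 1)}
  zero_mem' := by intro d; simp
  add_mem' := by
    intro f g hf hg d
    simpa using add_mem (hf d) (hg d)
  smul_mem' := by
    intro r f hf d
    have : (r • f).1 = r.1 * f.1 := rfl
    rw [this, Polynomial.coeff_mul, map_sum]
    refine sum_mem fun x hx => ?_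
    obtain ⟨j, hj, y, hy, hjy⟩ := Submodule.mem_sup.mp (hf x.2)
    rw [map_mul, ← hjy, mul_add]
    refine add_mem (Ideal.mem_sup_left (Ideal.mul_mem_left _ _ hj)) (Ideal.mem_sup_right ?_)
    have h1 : algebraMap A C (r.1.coeff x.1) ∈ (m.map (algebraMap A C)) ^ x.1 := by
      rw [← Ideal.map_pow]; exact Ideal.mem_map_of_mem _ (r.2 x.1)
    have := Ideal.mul_mem_mul h1 hy
    rwa [← pow_add, ← add_assoc, Finset.HasAntidiagonal.mem_antidiagonal.mp hx] at this

theorem isNoetherianRing_of_complete {A C : Type*} [CommRing A] [IsNoetherianRing A] [CommRing C]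
    [Algebra A C] (m : Ideal A)
    (hres : ∀ r : C, ∃ a : A, r - algebraMap A C a ∈ m.map (algebraMap A C))
    [IsAdicComplete (m.map (algebraMap A C)) C] : IsNoetherianRing C := by
  classical
  rw [isNoetherianRing_iff_ideal_fg]
  intro J
  set I := m.map (algebraMap A C) with hI
  obtain ⟨s, hs⟩ := (isNoetherianRing_iff_ideal_fg (reesAlgebra m)).mp inferInstance
    (leadIdeal (C := C) m J)
  have hmem : ∀ f ∈ s, f ∈ leadIdeal (C := C) m J := fun f hf => hs ▸ Ideal.subset_span hf
  have hex : ∀ (f : s) (k : ℕ), ∃ g ∈ J, algebraMap A C (f.1.1.coeff k) - g ∈ I ^ (k + 1) := by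
    intro f k
    obtain ⟨j, hj, y, hy, hjy⟩ := Submodule.mem_sup.mp (hmem f.1 f.2 k)
    exact ⟨j, hj, by rw [← hjy]; simpa using hy⟩
  choose G hGJ hG using hex
  let K : ℕ := s.sup fun f => f.1.natDegree
  have hK : ∀ f : s, f.1.1.natDegree ≤ K := fun f =>
    Finset.le_sup (f := fun f : reesAlgebra m => f.1.natDegree) f.2
  let g : s × Fin (K + 1) → C := fun p => G p.1 p.2
  have key := aux_complete I J g (fun p => hGJ _ _) K (by
    intro d c hcJ hcI
    obtain ⟨a, ha, hca⟩ := aux_lead m hres d c hcI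
    have hmon : (⟨Polynomial.monomial d a, reesAlgebra.monomial_mem.mpr ha⟩ : reesAlgebra m) ∈
        leadIdeal (C := C) m J := by
      intro e
      simp only [Polynomial.coeff_monomial]
      split_ifs with h
      · subst h
        have : algebraMap A C a = c + -(c - algebraMap A C a) := by ring
        rw [this]
        exact add_mem (Ideal.mem_sup_left hcJ) (Ideal.mem_sup_right (neg_mem hca))
      · simp
    rw [← hs] at hmon
    obtain ⟨r, -, hr⟩ := Submodule.mem_span_finset.mp hmon
    have hr2 : Polynomial.monomial d a = ∑ f ∈ s, (r f).1 * f.1 := by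
      have := congrArg (reesAlgebra m).val hr
      simpa using this.symm
    have hr3 : a = ∑ f : s, ∑ k : Fin (K + 1),
        (if k.1 ≤ d then (r f.1).1.coeff (d - k.1) else 0) * f.1.1.coeff k.1 := by
      have := congrArg (fun p => Polynomial.coeff p d) hr2
      simp only [Polynomial.coeff_monomial, if_true, Polynomial.finsetSum_coeff] at this
      rw [this, ← Finset.sum_coe_sort s]
      refine Finset.sum_congr rfl fun f _ => ?_
      rw [Polynomial.coeff_mul, ← Finset.Nat.sum_antidiagonal_swap,
        Finset.Nat.sum_antidiagonal_eq_sum_range_succ_mk,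
        Fin.sum_univ_eq_sum_range (fun k => (if k ≤ d then (r f.1).1.coeff (d - k) else 0) *
          f.1.1.coeff k) (K + 1)]
      have e1 : ∑ k ∈ Finset.range (d + 1), (r f.1).1.coeff (d - k) * f.1.1.coeff k =
          ∑ k ∈ Finset.range (max d K + 1), (if k ≤ d then (r f.1).1.coeff (d - k) else 0) *
          f.1.1.coeff k := by
        rw [← Finset.sum_subset (Finset.range_mono (show d + 1 ≤ max d K + 1 by omega))]
        · refine Finset.sum_congr rfl fun k hk => ?_
          rw [if_pos (by simpa [Nat.lt_succ_iff] using hk)]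
        · intro k _ hk
          rw [if_neg (by simp at hk; omega), zero_mul]
      have e2 : ∑ k ∈ Finset.range (K + 1), (if k ≤ d then (r f.1).1.coeff (d - k) else 0) *
          f.1.1.coeff k =
          ∑ k ∈ Finset.range (max d K + 1), (if k ≤ d then (r f.1).1.coeff (d - k) else 0) *
          f.1.1.coeff k := by
        apply Finset.sum_subset (Finset.range_mono (show K + 1 ≤ max d K + 1 by omega))
        intro k _ hk
        have hkf : f.1.1.natDegree < k := by
          have := hK f
          simp at hk; omega
        rw [Polynomial.coeff_eq_zero_of_natDegree_lt hkf, mul_zero]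
      rw [e2, ← e1]
      rfl
    let R : s × Fin (K + 1) → A := fun p =>
      if p.2.1 ≤ d then (r p.1.1).1.coeff (d - p.2.1) else 0
    have hR : ∀ p, p.2.1 ≤ d → algebraMap A C (R p) ∈ I ^ (d - p.2.1) := by
      intro p hp
      rw [hI, ← Ideal.map_pow]
      simp only [R, if_pos hp]
      exact Ideal.mem_map_of_mem _ ((r p.1.1).2 _)
    refine ⟨fun p => algebraMap A C (R p), fun p => ?_, ?_⟩
    · by_cases hp : p.2.1 ≤ d
      · exact Ideal.pow_le_pow_right (by have := p.2.2; omega) (hR p hp)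
      · simp [R, if_neg hp]
    · have h3 : algebraMap A C a = ∑ p : s × Fin (K + 1),
          algebraMap A C (R p) * algebraMap A C (p.1.1.1.coeff p.2.1) := by
        rw [hr3, Fintype.sum_prod_type]
        simp only [map_sum, map_mul, R]
      have h4 : ∑ p : s × Fin (K + 1), algebraMap A C (R p) *
          (algebraMap A C (p.1.1.1.coeff p.2.1) - g p) ∈ I ^ (d + 1) := by
        refine sum_mem fun p _ => ?_
        by_cases hp : p.2.1 ≤ d
        · have := Ideal.mul_mem_mul (hR p hp) (hG p.1 p.2)
          rw [← pow_add] at this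
          rwa [show d - p.2.1 + (p.2.1 + 1) = d + 1 by omega] at this
        · simp [R, if_neg hp]
      have := add_mem hca h4
      convert this using 1
      simp only [mul_sub, Finset.sum_sub_distrib]
      rw [← h3]
      ring)
  have : J = Ideal.span (Set.range g) :=
    le_antisymm key (Ideal.span_le.mpr (by rintro _ ⟨p, rfl⟩; exact hGJ _ _))
  rw [this]
  exact Submodule.fg_span (Set.finite_range g)

theorem isNoetherianRing_adicCompletion (A : Type*) [CommRing A] [IsNoetherianRing A]
    (m : Ideal A) : IsNoetherianRing (AdicCompletion m A) := by
  have fg := m.fg_of_isNoetherianRing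
  have := AdicCompletion.isAdicComplete_self m fg
  refine isNoetherianRing_of_complete m fun r => ?_
  rw [← AdicCompletion.ker_evalOneₐ_eq_map m fg]
  obtain ⟨a, ha⟩ := Ideal.Quotient.mk_surjective (AdicCompletion.evalOneₐ m r)
  refine ⟨a, ?_⟩
  rw [RingHom.mem_ker, map_sub, sub_eq_zero]
  have := RingHom.congr_fun (AdicCompletion.evalOneₐ_comp_algebraMap_eq_mk m) a
  exact ha.symm.trans this.symm

end Noeth

section Ass

theorem ass_tensor_subset {A C E : Type*} [CommRing A] [IsNoetherianRing A] [CommRing C]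
    [Algebra A C] [Module.Flat A C] [AddCommGroup E] [Module A E] :
    associatedPrimes A (C ⊗[A] E) ⊆ associatedPrimes A E := by
  classical
  intro p hp
  obtain ⟨hp1, y, hy⟩ := isAssociatedPrime_iff.mp hp
  have hyp : ∀ a, a ∈ p ↔ a • y = 0 := by
    intro a; rw [hy]; simp [Submodule.mem_colon_singleton]
  by_contra hcon
  obtain ⟨s, hs⟩ := p.fg_of_isNoetherianRing
  let f : E →ₗ[A] (s → E) := LinearMap.pi fun a => LinearMap.lsmul A E a.1
  have hfN : ∀ x : E, f x = 0 → ∀ a ∈ p, a • x = 0 := by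
    intro x hx a ha
    have : p ≤ LinearMap.ker (LinearMap.toSpanSingleton A E x) := by
      rw [← hs, Ideal.span_le]
      intro b hb
      simpa [f] using congrFun hx ⟨b, hb⟩
    simpa using this ha
  have hex : Function.Exact (LinearMap.ker f).subtype f := LinearMap.exact_subtype_ker_map f
  have hex2 := Module.Flat.lTensor_exact C hex
  have hy0 : f.lTensor C y = 0 := by
    apply (TensorProduct.piRight A A C (fun _ : s => E)).injective
    rw [map_zero]
    funext a
    have h1 : ∀ z : C ⊗[A] E,
        (TensorProduct.piRight A A C (fun _ : s => E)) (f.lTensor C z) a = a.1 • z := by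
      intro z
      induction z with
      | zero => simp
      | add u v hu hv => simp only [map_add, Pi.add_apply, hu, hv, smul_add]
      | tmul c e => simp [f]
    rw [h1]
    exact (hyp a.1).mp (hs ▸ Ideal.subset_span a.2)
  obtain ⟨z, hz⟩ := (hex2 y).mp hy0
  have hkill : ∀ z : C ⊗[A] (LinearMap.ker f), ∃ t, t ∉ p ∧ t • z = 0 := by
    intro z
    induction z with
    | zero => exact ⟨1, fun h => hp1.ne_top ((Ideal.eq_top_iff_one _).mpr h), by simp⟩
    | add u v hu hv =>
      obtain ⟨t, ht, ht'⟩ := hu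
      obtain ⟨w, hw, hw'⟩ := hv
      refine ⟨t * w, fun h => (hp1.mem_or_mem h).elim ht hw, ?_⟩
      rw [smul_add, mul_smul t w v, hw', mul_comm, mul_smul, ht']
      simp
    | tmul c x =>
      by_contra hno
      push Not at hno
      apply hcon
      refine isAssociatedPrime_iff.mpr ⟨hp1, x.1, ?_⟩
      ext a
      simp only [Submodule.mem_colon_singleton, Submodule.mem_bot]
      refine ⟨fun ha => hfN x.1 x.2 a ha, fun ha => ?_⟩
      by_contra hap
      apply hno a hap
      rw [← TensorProduct.tmul_smul]
      have : a • x = 0 := Subtype.ext ha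
      rw [this, TensorProduct.tmul_zero]
  obtain ⟨t, ht, htz⟩ := hkill z
  apply ht
  rw [hyp, ← hz, ← map_smul, htz, map_zero]

theorem ass_finite {A B M : Type*} [CommRing A] [IsNoetherianRing A] [CommRing B]
    [IsNoetherianRing B] [AddCommGroup M] [Module A M] [Module B M] [Module.Finite B M]
    (φ : A →+* B) (hφ : ∀ (a : A) (x : M), φ a • x = a • x) :
    (associatedPrimes A M).Finite := by
  refine ((associatedPrimes.finite B M).image (Ideal.comap φ)).subset ?_
  intro p hp
  obtain ⟨hp1, y, hy⟩ := isAssociatedPrime_iff.mp hp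
  have h : p = ((⊥ : Submodule B M).colon {y}).comap φ := by
    ext a
    rw [hy]
    simp [Submodule.mem_colon_singleton, hφ]
  obtain ⟨q, hq, hqp⟩ := Ideal.exists_minimalPrimes_comap_eq (I := (⊥ : Submodule B M).colon {y})
    φ p (by rw [← h, Ideal.minimalPrimes_eq_subsingleton_self]; rfl)
  exact ⟨q, isAssociatedPrime_iff.mpr
    ⟨hq.1.1, Submodule.exists_eq_colon_of_mem_minimalPrimes hq⟩, hqp⟩

end Ass


/-- Let `(A, 𝔪)` be Noetherian local with `𝔪`-adic completion `Â`, let `B` be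
a finitely generated `Â`-algebra whose structure map `Â → B` is injective, and let `E` be an
`A`-module such that `E ⊗_A Â` (realized as `Â ⊗[A] E`) is a finitely generated `B`-module.
Then `Ass_A E = Ass_A (E ⊗_A Â)`; in particular `Ass_A E` is finite. -/
theorem stmt9 (A : Type) [CommRing A] [IsLocalRing A] [IsNoetherianRing A]
    (B : Type) [CommRing B]
    [Algebra (AdicCompletion (IsLocalRing.maximalIdeal A) A) B]
    [Algebra.FiniteType (AdicCompletion (IsLocalRing.maximalIdeal A) A) B]
    (hinj : Function.Injective
      (algebraMap (AdicCompletion (IsLocalRing.maximalIdeal A) A) B))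
    (E : Type) [AddCommGroup E] [Module A E]
    [Module B ((AdicCompletion (IsLocalRing.maximalIdeal A) A) ⊗[A] E)]
    [IsScalarTower (AdicCompletion (IsLocalRing.maximalIdeal A) A) B
      ((AdicCompletion (IsLocalRing.maximalIdeal A) A) ⊗[A] E)]
    [Module.Finite B ((AdicCompletion (IsLocalRing.maximalIdeal A) A) ⊗[A] E)] :
    associatedPrimes A E =
      associatedPrimes A ((AdicCompletion (IsLocalRing.maximalIdeal A) A) ⊗[A] E) ∧
    (associatedPrimes A E).Finite := by
  have hC : IsNoetherianRing (AdicCompletion (IsLocalRing.maximalIdeal A) A) :=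
    isNoetherianRing_adicCompletion A _
  have hB : IsNoetherianRing B :=
    Algebra.FiniteType.isNoetherianRing (AdicCompletion (IsLocalRing.maximalIdeal A) A) B
  have hff : Module.FaithfullyFlat A (AdicCompletion (IsLocalRing.maximalIdeal A) A) :=
    Module.FaithfullyFlat.of_flat_of_isLocalHom
  have hsub : associatedPrimes A E ⊆
      associatedPrimes A ((AdicCompletion (IsLocalRing.maximalIdeal A) A) ⊗[A] E) :=
    associatedPrimes.subset_of_injective
      (f := TensorProduct.mk A (AdicCompletion (IsLocalRing.maximalIdeal A) A) E 1)
      (Module.FaithfullyFlat.tensorProduct_mk_injective E)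
  refine ⟨Set.Subset.antisymm hsub ass_tensor_subset, Set.Finite.subset ?_ hsub⟩
  refine ass_finite (B := B)
    ((algebraMap (AdicCompletion (IsLocalRing.maximalIdeal A) A) B).comp (algebraMap A _)) ?_
  intro a x
  rw [RingHom.comp_apply, algebraMap_smul, algebraMap_smul]
end
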